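/- arXiv:2012.00591 — 14 statements merged into one kernel-verified Lean document; each statement's English description precedes it below -/
import Mathlib

section
/- Let E be an n-dimensional real vector space (n ≥ 1), let Γ ≤ E be a subgroup of the additive group of E which is free abelian of rank k, and let f be a flag, i.e. a set of n linear hyperplanes of E whose intersection is {0}. Then Σ_{V ∈ f} (k − rk(Γ ∩ V)) ≥ k; equivalently, Σ_{V ∈ f} rk(Γ ∩ V) ≤ (n−1)·k. (This is the core of the paper's lemma that every flag complexity exponent α_f is at least d = k − n for hyperplane-spanning polytopal cut and project schemes; it is proved via the injection of Γ into the direct sum of the quotients Γ/(Γ ∩ V) over V ∈ f.) -/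
/-- In a Noetherian submodule `N`, the rank of `N` exceeds that of its intersection with finitely
many submodules by at most the sum of the individual coranks in `N`. -/
theorem Submodule.finrank_le_finrank_inf_add_sum {R M ι : Type*} [CommRing R] [IsDomain R]
    [AddCommGroup M] [Module R M] (N : Submodule R M) [IsNoetherian R N]
    (s : Finset ι) (P : ι → Submodule R M) :
    Module.finrank R N ≤ Module.finrank R ↥(N ⊓ s.inf P) +
      ∑ i ∈ s, (Module.finrank R N - Module.finrank R ↥(N ⊓ P i)) := by
  classical
  induction s using Finset.induction_on with
  | empty => rw [Finset.inf_empty, inf_top_eq, Finset.sum_empty, add_zero]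
  | insert a s ha ih =>
    have hle {L : Submodule R M} (h : L ≤ N) : Module.Finite R L :=
      have := isNoetherian_of_le h
      inferInstance
    have hA := hle (inf_le_left : N ⊓ s.inf P ≤ N)
    have hB := hle (inf_le_left : N ⊓ P a ≤ N)
    have hN := hle le_rfl
    have hS := hle (sup_le inf_le_left inf_le_left : (N ⊓ s.inf P) ⊔ (N ⊓ P a) ≤ N)
    have hI := hle (inf_le_left.trans inf_le_left : (N ⊓ s.inf P) ⊓ (N ⊓ P a) ≤ N)
    have hmod := Submodule.rank_sup_add_rank_inf_eq (N ⊓ s.inf P) (N ⊓ P a)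
    simp only [← Module.finrank_eq_rank] at hmod
    norm_cast at hmod
    have hsup : Module.finrank R ↥((N ⊓ s.inf P) ⊔ (N ⊓ P a)) ≤ Module.finrank R N :=
      Submodule.finrank_mono (sup_le inf_le_left inf_le_left)
    rw [← inf_inf_distrib_left, inf_comm (s.inf P)] at hmod
    rw [Finset.inf_insert, Finset.sum_insert ha]
    omega


/-- For a free abelian subgroup `Γ` of rank `k` of an `n`-dimensional real
vector space `E`, and a flag `f` (a set of `n` linear hyperplanes with trivial intersection),
we have `Σ_{V ∈ f} (k − rk(Γ ∩ V)) ≥ k`, equivalently `Σ_{V ∈ f} rk(Γ ∩ V) ≤ (n−1)·k`. -/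
theorem stmt_0 (n k : ℕ) (hn : 1 ≤ n)
    (E : Type*) [AddCommGroup E] [Module ℝ E]
    (hE : Module.finrank ℝ E = n)
    (Γ : AddSubgroup E) [Module.Free ℤ ↥Γ] [Module.Finite ℤ ↥Γ]
    (hΓ : Module.finrank ℤ ↥Γ = k)
    (f : Finset (Submodule ℝ E))
    (hcard : f.card = n)
    (hhyp : ∀ V ∈ f, Module.finrank ℝ ↥V = n - 1)
    (hflag : f.inf id = ⊥) :
    k ≤ ∑ V ∈ f, (k - Module.finrank ℤ ↥(Γ ⊓ V.toAddSubgroup)) ∧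
      ∑ V ∈ f, Module.finrank ℤ ↥(Γ ⊓ V.toAddSubgroup) ≤ (n - 1) * k := by
  let N : Submodule ℤ E := AddSubgroup.toIntSubmodule Γ
  have : Module.Finite ℤ N := ‹Module.Finite ℤ Γ›
  have hN : Module.finrank ℤ N = k := hΓ
  have hbot : f.inf (fun V ↦ V.restrictScalars ℤ) = ⊥ := by
    rw [eq_bot_iff]
    intro x hx
    have hx' : x ∈ f.inf id := by
      simpa [Submodule.mem_finsetInf] using hx
    simpa [hflag] using hx'
  have hk := N.finrank_le_finrank_inf_add_sum f (fun V ↦ V.restrictScalars ℤ)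
  rw [hbot, inf_bot_eq, finrank_bot, zero_add, hN] at hk
  have hV (V : Submodule ℝ E) : Module.finrank ℤ ↥(Γ ⊓ V.toAddSubgroup) ≤ k :=
    hN ▸ Submodule.finrank_mono (inf_le_left : N ⊓ V.restrictScalars ℤ ≤ N)
  have hk' : k ≤ ∑ V ∈ f, (k - Module.finrank ℤ ↥(Γ ⊓ V.toAddSubgroup)) := hk
  refine ⟨hk', ?_⟩
  have hsum : ∑ V ∈ f, (k - Module.finrank ℤ ↥(Γ ⊓ V.toAddSubgroup)) +
      ∑ V ∈ f, Module.finrank ℤ ↥(Γ ⊓ V.toAddSubgroup) = n * k := by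
    rw [← Finset.sum_add_distrib, Finset.sum_congr rfl fun V _ ↦ Nat.sub_add_cancel (hV V)]
    simp [hcard]
  rw [Nat.sub_mul, one_mul]
  omega
end

section
/- Let Γ ≤ ℝ^n be a dense subgroup which is free abelian of rank k, and let f = {V₁,…,V_n} be a flag of linear hyperplanes of ℝ^n (so ⋂_{i=1}^n V_i = {0}) satisfying Σ_{i=1}^n rk(Γ ∩ V_i) = (n−1)·k. For each i = 1,…,n let L(i) = ⋂_{j ≠ i} V_j. Then: each L(i) is a one-dimensional linear subspace; ℝ^n is the internal direct sum L(1) ⊕ ⋯ ⊕ L(n); rk(Γ ∩ L(i)) ≥ k − rk(Γ ∩ V_i) for each i; and (Γ ∩ L(1)) + (Γ ∩ L(2)) + ⋯ + (Γ ∩ L(n)) is a finite index subgroup of Γ. -/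
namespace Submodule

open Module

variable {R M ι : Type*} [CommRing R] [AddCommGroup M] [Module R M]

theorem disjoint_iInf_ne_of_iInf_eq_bot {W : ι → Submodule R M} (hW : ⨅ i, W i = ⊥) (i : ι) :
    Disjoint (⨅ j, ⨅ (_ : j ≠ i), W j) (W i) := by
  rw [disjoint_iff, ← le_bot_iff, ← hW]
  refine le_iInf fun j => ?_
  by_cases h : j = i
  · exact h ▸ inf_le_right
  · exact inf_le_left.trans (iInf₂_le j h)

theorem iSupIndep_iInf_ne_of_iInf_eq_bot {W : ι → Submodule R M} (hW : ⨅ i, W i = ⊥) :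
    iSupIndep fun i => ⨅ j, ⨅ (_ : j ≠ i), W j :=
  fun i => (disjoint_iInf_ne_of_iInf_eq_bot hW i).mono_right <|
    iSup₂_le fun _ hj => iInf₂_le i hj.symm

variable [IsDomain R] [IsNoetherianRing R]

theorem finrank_sup_add_finrank_inf_eq_of_isDomain (s t : Submodule R M)
    [Module.Finite R s] [Module.Finite R t] :
    finrank R ↥(s ⊔ t) + finrank R ↥(s ⊓ t) = finrank R s + finrank R t := by
  have : Module.Finite R ↥(s ⊓ t) := Module.Finite.of_injective
    (inclusion (inf_le_left : s ⊓ t ≤ s)) (inclusion_injective _)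
  have key := rank_sup_add_rank_inf_eq s t
  simp only [← finrank_eq_rank] at key
  exact_mod_cast key

/-- The corank of a finite intersection is at most the sum of the coranks. -/
theorem sum_finrank_inf_add_finrank_le [DecidableEq ι] (P : Submodule R M) [Module.Finite R P]
    (W : ι → Submodule R M) (s : Finset ι) :
    ∑ j ∈ s, finrank R ↥(P ⊓ W j) + finrank R P ≤
      finrank R ↥(P ⊓ ⨅ j ∈ s, W j) + s.card * finrank R P := by
  induction s using Finset.induction_on with
  | empty =>
    have h : P ⊓ ⨅ j ∈ (∅ : Finset ι), W j = P := by simp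
    rw [h]
    simp
  | insert a s ha ih =>
    have hfin (Q : Submodule R M) : Module.Finite R ↥(P ⊓ Q) := Module.Finite.of_injective
      (inclusion (inf_le_left : P ⊓ Q ≤ P)) (inclusion_injective _)
    have h := finrank_sup_add_finrank_inf_eq_of_isDomain (P ⊓ W a) (P ⊓ ⨅ j ∈ s, W j)
    have hle : finrank R ↥((P ⊓ W a) ⊔ (P ⊓ ⨅ j ∈ s, W j)) ≤ finrank R P :=
      finrank_mono (sup_le inf_le_left inf_le_left)
    rw [← inf_inf_distrib_left] at h
    rw [Finset.sum_insert ha, Finset.iInf_insert, Finset.card_insert_of_notMem ha, add_mul]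
    omega

theorem finrank_biSup_eq_sum_of_iSupIndep [DecidableEq ι] {K : ι → Submodule R M}
    [∀ i, Module.Finite R (K i)] (hK : iSupIndep K) (s : Finset ι) :
    finrank R ↥(⨆ i ∈ s, K i) = ∑ i ∈ s, finrank R (K i) := by
  induction s using Finset.induction_on with
  | empty =>
    have h : ⨆ i ∈ (∅ : Finset ι), K i = ⊥ := by simp
    rw [h, finrank_bot, Finset.sum_empty]
  | insert a s ha ih =>
    have : Module.Finite R ↥(⨆ i ∈ s, K i) :=
      Module.Finite.iff_fg.2 (fg_biSup s K fun i _ => Module.Finite.iff_fg.1 inferInstance)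
    have h := finrank_sup_add_finrank_inf_eq_of_isDomain (K a) (⨆ i ∈ s, K i)
    have hd : Disjoint (K a) (⨆ i ∈ s, K i) := hK.disjoint_biSup (y := (s : Set ι)) ha
    rw [hd.eq_bot, finrank_bot, add_zero] at h
    rw [Finset.sum_insert ha, Finset.iSup_insert, h, ih]

theorem finrank_iSup_eq_sum_of_iSupIndep [Fintype ι] {K : ι → Submodule R M}
    [∀ i, Module.Finite R (K i)] (hK : iSupIndep K) :
    finrank R ↥(⨆ i, K i) = ∑ i, finrank R (K i) := by
  classical
  have h : ⨆ i ∈ Finset.univ, K i = ⨆ i, K i := by simp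
  rw [← h, finrank_biSup_eq_sum_of_iSupIndep hK]

/-- The corank of the intersection of all but one member of a family is at most the sum of
the coranks of the remaining members. -/
theorem sum_finrank_inf_add_finrank_le_of_ne [Fintype ι] (P : Submodule R M)
    [Module.Finite R P] (W : ι → Submodule R M) (i : ι) :
    ∑ j, finrank R ↥(P ⊓ W j) + finrank R P ≤
      finrank R ↥(P ⊓ ⨅ j, ⨅ (_ : j ≠ i), W j) + finrank R ↥(P ⊓ W i) +
        (Fintype.card ι - 1) * finrank R P := by
  classical
  have h := sum_finrank_inf_add_finrank_le P W (Finset.univ.erase i)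
  have hs := Finset.sum_erase_add Finset.univ (fun j => finrank R ↥(P ⊓ W j)) (Finset.mem_univ i)
  have he : ⨅ j ∈ Finset.univ.erase i, W j = ⨅ j, ⨅ (_ : j ≠ i), W j := by simp
  rw [he, Finset.card_erase_of_mem (Finset.mem_univ i), Finset.card_univ] at h
  omega

end Submodule

theorem AddSubgroup.index_addSubgroupOf_ne_zero_of_finrank_eq {A : Type*} [AddCommGroup A]
    {S G : AddSubgroup A} [Module.Free ℤ G] [Module.Finite ℤ G] (hle : S ≤ G)
    (h : Module.finrank ℤ S = Module.finrank ℤ G) : (S.addSubgroupOf G).index ≠ 0 := by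
  have : Finite (G ⧸ toIntSubmodule (S.addSubgroupOf G)) := by
    refine Submodule.finiteQuotientOfFreeOfRankEq _ ?_
    rw [← h]
    exact (addSubgroupOfEquivOfLe hle).toIntLinearEquiv.finrank_eq
  have : Finite (G ⧸ S.addSubgroupOf G) := this
  exact index_ne_zero_of_finite

open Module in
/-- Let `Γ ≤ ℝ^n` be a dense free abelian subgroup of rank `k` and
`f = {V₁,…,V_n}` a flag of linear hyperplanes with `Σ rk(Γ ∩ V_i) = (n−1)·k`.
With `L(i) = ⋂_{j ≠ i} V_j`: each `L(i)` is a line, `ℝ^n = L(1) ⊕ ⋯ ⊕ L(n)`,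
`rk(Γ ∩ L(i)) ≥ k − rk(Γ ∩ V_i)`, and `Σᵢ (Γ ∩ L(i))` has finite index in `Γ`. -/
theorem stmt_2 (n k : ℕ) (hn : 1 ≤ n)
    (Γ : AddSubgroup (Fin n → ℝ)) (hdense : Dense (Γ : Set (Fin n → ℝ)))
    [Module.Free ℤ ↥Γ] [Module.Finite ℤ ↥Γ] (hΓ : Module.finrank ℤ ↥Γ = k)
    (V : Fin n → Submodule ℝ (Fin n → ℝ)) (hVinj : Function.Injective V)
    (hhyp : ∀ i, Module.finrank ℝ ↥(V i) = n - 1)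
    (hflag : ⨅ i, V i = ⊥)
    (hrank : ∑ i, Module.finrank ℤ ↥(Γ ⊓ (V i).toAddSubgroup) = (n - 1) * k) :
    (∀ i, Module.finrank ℝ ↥(⨅ j, ⨅ (_ : j ≠ i), V j) = 1) ∧
    DirectSum.IsInternal (fun i => ⨅ j, ⨅ (_ : j ≠ i), V j) ∧
    (∀ i, k ≤ Module.finrank ℤ ↥(Γ ⊓ (⨅ j, ⨅ (_ : j ≠ i), V j).toAddSubgroup)
        + Module.finrank ℤ ↥(Γ ⊓ (V i).toAddSubgroup)) ∧
    ((⨆ i, Γ ⊓ (⨅ j, ⨅ (_ : j ≠ i), V j).toAddSubgroup).addSubgroupOf Γ).index ≠ 0 := by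
  obtain ⟨m, rfl⟩ : ∃ m, n = m + 1 := ⟨n - 1, by omega⟩
  simp only [Nat.add_sub_cancel] at hhyp hrank
  have hline (i) : finrank ℝ ↥(⨅ j, ⨅ (_ : j ≠ i), V j) = 1 := by
    have h₁ := Submodule.sum_finrank_inf_add_finrank_le_of_ne ⊤ V i
    have h₂ := Submodule.finrank_add_finrank_le_of_disjoint
      (Submodule.disjoint_iInf_ne_of_iInf_eq_bot hflag i)
    have hV (j) : finrank ℝ ↥(⊤ ⊓ V j) = m := by rw [top_inf_eq, hhyp]
    rw [top_inf_eq] at h₁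
    simp only [hV, hhyp, finrank_top, finrank_fin_fun, Finset.sum_const, Finset.card_univ,
      Fintype.card_fin, smul_eq_mul, Nat.add_sub_cancel] at h₁ h₂
    rw [mul_comm m (m + 1)] at h₁
    omega
  have hind := Submodule.iSupIndep_iInf_ne_of_iInf_eq_bot hflag
  let W (j : Fin (m + 1)) : Submodule ℤ (Fin (m + 1) → ℝ) := (V j).restrictScalars ℤ
  let P : Submodule ℤ (Fin (m + 1) → ℝ) := AddSubgroup.toIntSubmodule Γ
  have hWflag : ⨅ i, W i = ⊥ := by
    ext x
    have := congrArg (x ∈ ·) hflag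
    simpa [W] using this
  have hL (i) : Γ ⊓ (⨅ j, ⨅ (_ : j ≠ i), V j).toAddSubgroup =
      (P ⊓ ⨅ j, ⨅ (_ : j ≠ i), W j).toAddSubgroup := by
    ext x
    have hP : x ∈ P ↔ x ∈ Γ := Iff.rfl
    simp [hP, W]
  have hfin (Q : Submodule ℤ (Fin (m + 1) → ℝ)) : Module.Finite ℤ ↥(P ⊓ Q) :=
    have : Module.Finite ℤ P := ‹Module.Finite ℤ Γ›
    Module.Finite.of_injective (Submodule.inclusion (inf_le_left : P ⊓ Q ≤ P))
      (Submodule.inclusion_injective _)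
  have hlow (i) : k ≤ finrank ℤ ↥(P ⊓ ⨅ j, ⨅ (_ : j ≠ i), W j) + finrank ℤ ↥(P ⊓ W i) := by
    have : Module.Finite ℤ P := ‹Module.Finite ℤ Γ›
    have h := Submodule.sum_finrank_inf_add_finrank_le_of_ne P W i
    have hP : finrank ℤ P = k := hΓ
    have hsum : ∑ i, finrank ℤ ↥(P ⊓ W i) = m * k := hrank
    rw [hsum, hP, Fintype.card_fin, Nat.add_sub_cancel] at h
    omega
  refine ⟨hline, DirectSum.isInternal_submodule_of_iSupIndep_of_iSup_eq_top hind ?_, ?_, ?_⟩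
  · apply Submodule.eq_top_of_finrank_eq
    rw [Submodule.finrank_iSup_eq_sum_of_iSupIndep hind]
    simp [hline]
  · intro i
    rw [hL]
    exact hlow i
  · apply AddSubgroup.index_addSubgroupOf_ne_zero_of_finrank_eq (iSup_le fun i => inf_le_left)
    have hindP : iSupIndep fun i => P ⊓ ⨅ j, ⨅ (_ : j ≠ i), W j :=
      (Submodule.iSupIndep_iInf_ne_of_iInf_eq_bot hWflag).mono fun i => inf_le_right
    have hsup : ⨆ i, Γ ⊓ (⨅ j, ⨅ (_ : j ≠ i), V j).toAddSubgroup =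
        (⨆ i, P ⊓ ⨅ j, ⨅ (_ : j ≠ i), W j).toAddSubgroup := by
      simp only [hL]
      exact (AddSubgroup.toIntSubmodule.symm.map_iSup _).symm
    have hS : finrank ℤ ↥(⨆ i, P ⊓ ⨅ j, ⨅ (_ : j ≠ i), W j) =
      ∑ i, finrank ℤ ↥(P ⊓ ⨅ j, ⨅ (_ : j ≠ i), W j) :=
        Submodule.finrank_iSup_eq_sum_of_iSupIndep hindP
    have hle : finrank ℤ ↥(⨆ i, P ⊓ ⨅ j, ⨅ (_ : j ≠ i), W j) ≤ finrank ℤ P :=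
      have : Module.Finite ℤ P := ‹Module.Finite ℤ Γ›
      Submodule.finrank_mono (iSup_le fun i => inf_le_left)
    have hP : finrank ℤ P = k := hΓ
    have hsum : ∑ i, finrank ℤ ↥(P ⊓ W i) = m * k := hrank
    have hge := Finset.sum_le_sum fun i (_ : i ∈ Finset.univ) => hlow i
    rw [Finset.sum_add_distrib, hsum, ← hS, Finset.sum_const, Finset.card_univ,
      Fintype.card_fin, smul_eq_mul, add_mul, one_mul] at hge
    rw [hsup, hΓ]
    change finrank ℤ ↥(⨆ i, P ⊓ ⨅ j, ⨅ (_ : j ≠ i), W j) = k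
    omega
end

section
/- Let E be an n-dimensional real vector space and ℋ₀ a finite set of linear hyperplanes of E whose common intersection is {0}. Let ℋ₀ = A ⊔ B be a partition into nonempty subsets, and set X_A = ⋂_{V∈A} V and X_B = ⋂_{V∈B} V. Then X_A + X_B = E (i.e. the partition is a decomposition) if and only if no edge of the flag graph G(ℋ₀) joins an element of A to an element of B. -/
open scoped Classical

/-- A flag in `ℋ₀`: an `n`-element subset of `ℋ₀` whose intersection is `{0}`. -/
def IsFlag {E : Type*} [AddCommGroup E] [Module ℝ E] (n : ℕ)
    (H0 f : Finset (Submodule ℝ E)) : Prop :=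
  f ⊆ H0 ∧ f.card = n ∧ f.inf id = ⊥

/-- The flag graph `G(ℋ₀)`: `V₁ ∼ V₂` iff `V₁ ≠ V₂` and some pre-flag `f` is completed to
a flag by adjoining either `V₁` or `V₂`. -/
def FlagAdj {E : Type*} [AddCommGroup E] [Module ℝ E] (n : ℕ)
    (H0 : Finset (Submodule ℝ E)) (V₁ V₂ : Submodule ℝ E) : Prop :=
  V₁ ≠ V₂ ∧ ∃ f : Finset (Submodule ℝ E), V₁ ∉ f ∧ V₂ ∉ f ∧
    IsFlag n H0 (insert V₁ f) ∧ IsFlag n H0 (insert V₂ f)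

theorem le_finrank_finset_inf_add_card {E : Type*} [AddCommGroup E] [Module ℝ E]
    [FiniteDimensional ℝ E] (s : Finset (Submodule ℝ E))
    (hs : ∀ V ∈ s, Module.finrank ℝ V = Module.finrank ℝ E - 1) :
    Module.finrank ℝ E ≤ Module.finrank ℝ (s.inf id : Submodule ℝ E) + s.card := by
  induction s using Finset.induction_on with
  | empty => rw [Finset.inf_empty, finrank_top, Finset.card_empty, add_zero]
  | insert V s hV ih =>
    have h₁ := ih fun W hW => hs W (Finset.mem_insert_of_mem hW)
    have h₂ := hs V (Finset.mem_insert_self V s)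
    have h₃ := Submodule.finrank_sup_add_finrank_inf_eq V (s.inf id)
    have h₄ := Submodule.finrank_le (V ⊔ s.inf id)
    rw [Finset.inf_insert, Finset.card_insert_of_notMem hV, id]
    omega

/-- Nonzero vectors on the lines cut out by omitting one member of a family of subspaces with
trivial intersection are linearly independent. -/
theorem linearIndependent_of_mem_inf_erase {E : Type*} [AddCommGroup E] [Module ℝ E]
    {F : Finset (Submodule ℝ E)} (hF : F.inf id = ⊥) (v : F → E)
    (hv : ∀ W : F, v W ∈ (F.erase W).inf id) (hv₀ : ∀ W, v W ≠ 0) :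
    LinearIndependent ℝ v := by
  rw [Fintype.linearIndependent_iff]
  intro c hc W
  have hmem : ∀ U : F, U ≠ W → v U ∈ W.1 := fun U hU =>
    (Finset.inf_le (f := id)
      (Finset.mem_erase.2 ⟨fun h => hU (Subtype.ext h.symm), W.2⟩)) (hv U)
  have hsum : c W • v W ∈ W.1 := by
    rw [← Finset.add_sum_erase _ _ (Finset.mem_univ W)] at hc
    rw [eq_neg_of_add_eq_zero_left hc]
    exact neg_mem (sum_mem fun U hU => W.1.smul_mem _ (hmem U (Finset.ne_of_mem_erase hU)))
  by_contra hcW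
  have hvW : v W ∈ W.1 := (Submodule.smul_mem_iff _ hcW).1 hsum
  have hbot : v W ∈ F.inf id := by
    rw [← Finset.insert_erase W.2, Finset.inf_insert]
    exact ⟨hvW, hv W⟩
  rw [hF] at hbot
  exact hv₀ W hbot

theorem exists_isFlag {E : Type*} [AddCommGroup E] [Module ℝ E]
    [FiniteDimensional ℝ E] {H0 : Finset (Submodule ℝ E)}
    (hhyp : ∀ V ∈ H0, Module.finrank ℝ V = Module.finrank ℝ E - 1)
    (hint : H0.inf id = ⊥) : ∃ F, IsFlag (Module.finrank ℝ E) H0 F := by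
  obtain ⟨F, hFH, hF⟩ := exists_minimal_le_of_wellFoundedLT
    (fun F : Finset (Submodule ℝ E) => F.inf id = ⊥) H0 hint
  refine ⟨F, hFH, le_antisymm ?_ ?_, hF.prop⟩
  · have hne : ∀ W : F, ∃ x ∈ (F.erase W).inf id, x ≠ 0 := fun W =>
      Submodule.exists_mem_ne_zero_of_ne_bot fun h =>
        hF.not_prop_of_lt (Finset.erase_ssubset W.2) h
    choose v hv hv₀ using hne
    simpa using (linearIndependent_of_mem_inf_erase hF.prop v hv hv₀).fintype_card_le_finrank
  · have h := le_finrank_finset_inf_add_card F fun V hV => hhyp V (hFH hV)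
    rw [hF.prop] at h
    simpa using h

theorem finset_inf_ne_bot_of_card_lt {E : Type*} [AddCommGroup E] [Module ℝ E]
    [FiniteDimensional ℝ E] {s : Finset (Submodule ℝ E)}
    (hs : ∀ V ∈ s, Module.finrank ℝ V = Module.finrank ℝ E - 1)
    (hcard : s.card < Module.finrank ℝ E) : s.inf id ≠ ⊥ := by
  intro h
  have h' := le_finrank_finset_inf_add_card s hs
  rw [h, finrank_bot] at h'
  omega

/-- The lines cut out by omitting one member of a flag span the whole space. -/
theorem IsFlag.top_le_of_inf_erase_le {E : Type*} [AddCommGroup E] [Module ℝ E]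
    [FiniteDimensional ℝ E] {H0 F : Finset (Submodule ℝ E)}
    (hhyp : ∀ V ∈ H0, Module.finrank ℝ V = Module.finrank ℝ E - 1)
    (hF : IsFlag (Module.finrank ℝ E) H0 F) {X : Submodule ℝ E}
    (hX : ∀ W ∈ F, (F.erase W).inf id ≤ X) : ⊤ ≤ X := by
  have hne : ∀ W : F, ∃ x ∈ (F.erase W).inf id, x ≠ 0 := fun W =>
    Submodule.exists_mem_ne_zero_of_ne_bot <| finset_inf_ne_bot_of_card_lt
      (fun V hV => hhyp V (hF.1 (Finset.mem_of_mem_erase hV)))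
      (hF.2.1 ▸ Finset.card_erase_lt_of_mem W.2)
  choose v hv hv₀ using hne
  have hli := linearIndependent_of_mem_inf_erase hF.2.2 v hv hv₀
  rw [← hli.span_eq_top_of_card_eq_finrank' (by simpa using hF.2.1), Submodule.span_le]
  rintro _ ⟨W, rfl⟩
  exact hX W W.2 (hv W)

theorem FlagAdj.symm {E : Type*} [AddCommGroup E] [Module ℝ E] {n : ℕ}
    {H0 : Finset (Submodule ℝ E)} {V₁ V₂ : Submodule ℝ E} (h : FlagAdj n H0 V₁ V₂) :
    FlagAdj n H0 V₂ V₁ := by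
  obtain ⟨hne, f, h₁, h₂, hf₁, hf₂⟩ := h
  exact ⟨hne.symm, f, h₂, h₁, hf₂, hf₁⟩

theorem IsFlag.inf_erase_le_of_not_flagAdj {E : Type*} [AddCommGroup E] [Module ℝ E]
    [FiniteDimensional ℝ E] {H0 F : Finset (Submodule ℝ E)}
    (hhyp : ∀ V ∈ H0, Module.finrank ℝ V = Module.finrank ℝ E - 1)
    (hF : IsFlag (Module.finrank ℝ E) H0 F) {V W : Submodule ℝ E} (hV : V ∈ H0) (hW : W ∈ F)
    (hne : V ≠ W) (hadj : ¬ FlagAdj (Module.finrank ℝ E) H0 V W) :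
    (F.erase W).inf id ≤ V := by
  by_cases hVF : V ∈ F
  · exact Finset.inf_le (f := id) (Finset.mem_erase.2 ⟨hne, hVF⟩)
  have hVf : V ∉ F.erase W := fun h => hVF (Finset.mem_of_mem_erase h)
  have hmeet : V ⊓ (F.erase W).inf id ≠ ⊥ := by
    intro hbot
    refine hadj ⟨hne, F.erase W, hVf, Finset.notMem_erase W F, ⟨?_, ?_, ?_⟩, ?_⟩
    · exact Finset.insert_subset hV ((Finset.erase_subset W F).trans hF.1)
    · rw [Finset.card_insert_of_notMem hVf, Finset.card_erase_add_one hW, hF.2.1]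
    · rw [Finset.inf_insert]
      exact hbot
    · rwa [Finset.insert_erase hW]
  have hdisj : Disjoint W ((F.erase W).inf id) := by
    have h := hF.2.2
    rw [← Finset.insert_erase hW, Finset.inf_insert] at h
    exact disjoint_iff.2 h
  have h₁ := Submodule.finrank_add_finrank_le_of_disjoint hdisj
  have h₂ := hhyp W (hF.1 hW)
  have h₃ := Submodule.one_le_finrank_iff.2 hmeet
  have h₄ := Submodule.eq_of_le_of_finrank_le
    (inf_le_right : V ⊓ (F.erase W).inf id ≤ (F.erase W).inf id) (by omega)
  exact inf_eq_right.1 h₄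

/-- If the two intersections span, then no nonzero vector of the intersection of a subfamily can
be separated from it by both a member of `A` and a member of `B`. -/
theorem inf_eq_bot_of_inf_sup_inf_eq_top {E : Type*} [AddCommGroup E] [Module ℝ E]
    {A B f : Finset (Submodule ℝ E)} {V₁ V₂ : Submodule ℝ E}
    (htop : A.inf id ⊔ B.inf id = ⊤) (hf : f ⊆ A ∪ B) (hV₁ : V₁ ∈ A) (hV₂ : V₂ ∈ B)
    (h₁ : (insert V₁ f).inf id = ⊥) (h₂ : (insert V₂ f).inf id = ⊥) : f.inf id = ⊥ := by
  rw [Finset.inf_insert] at h₁ h₂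
  rw [Submodule.eq_bot_iff]
  intro x hx
  obtain ⟨a, ha, b, hb, rfl⟩ := Submodule.mem_sup.1 (htop ▸ Submodule.mem_top : x ∈ _)
  simp only [Submodule.mem_finsetInf, id] at ha hb hx
  have hab : ∀ V ∈ f, a ∈ V ∧ b ∈ V := fun V hV => by
    rcases Finset.mem_union.1 (hf hV) with hVA | hVB
    · exact ⟨ha V hVA, (Submodule.add_mem_iff_right _ (ha V hVA)).1 (hx V hV)⟩
    · exact ⟨(Submodule.add_mem_iff_left _ (hb V hVB)).1 (hx V hV), hb V hVB⟩
  have ha₀ : a ∈ (id V₁ ⊓ f.inf id : Submodule ℝ E) :=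
    ⟨ha V₁ hV₁, (Submodule.mem_finsetInf).2 fun V hV => (hab V hV).1⟩
  have hb₀ : b ∈ (id V₂ ⊓ f.inf id : Submodule ℝ E) :=
    ⟨hb V₂ hV₂, (Submodule.mem_finsetInf).2 fun V hV => (hab V hV).2⟩
  rw [h₁, Submodule.mem_bot] at ha₀
  rw [h₂, Submodule.mem_bot] at hb₀
  rw [ha₀, hb₀, add_zero]

/-- A partition `ℋ₀ = A ⊔ B` into nonempty parts satisfies
`X_A + X_B = E` (is a decomposition) iff no edge of the flag graph joins `A` to `B`. -/
theorem stmt_3 (n : ℕ) (hn : 1 ≤ n)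
    (E : Type*) [AddCommGroup E] [Module ℝ E] (hE : Module.finrank ℝ E = n)
    (H0 : Finset (Submodule ℝ E))
    (hhyp : ∀ V ∈ H0, Module.finrank ℝ ↥V = n - 1)
    (hint : H0.inf id = ⊥)
    (A B : Finset (Submodule ℝ E))
    (hunion : A ∪ B = H0) (hdisj : Disjoint A B)
    (hA : A.Nonempty) (hB : B.Nonempty) :
    A.inf id ⊔ B.inf id = ⊤ ↔ ¬ ∃ V₁ ∈ A, ∃ V₂ ∈ B, FlagAdj n H0 V₁ V₂ := by
  have : FiniteDimensional ℝ E := Module.finite_of_finrank_pos (by omega)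
  subst hE hunion
  constructor
  · rintro htop ⟨V₁, hV₁, V₂, hV₂, -, f, hV₁f, -, hf₁, hf₂⟩
    have hf : f ⊆ A ∪ B := (Finset.subset_insert V₁ f).trans hf₁.1
    have hcard := hf₁.2.1
    rw [Finset.card_insert_of_notMem hV₁f] at hcard
    exact finset_inf_ne_bot_of_card_lt (fun V hV => hhyp V (hf hV)) (by omega)
      (inf_eq_bot_of_inf_sup_inf_eq_top htop hf hV₁ hV₂ hf₁.2.2 hf₂.2.2)
  · intro hno
    obtain ⟨F, hF⟩ := exists_isFlag hhyp hint
    refine top_le_iff.1 (hF.top_le_of_inf_erase_le hhyp fun W hW => ?_)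
    rcases Finset.mem_union.1 (hF.1 hW) with hWA | hWB
    · refine le_sup_of_le_right (Finset.le_inf fun V hV => ?_)
      exact hF.inf_erase_le_of_not_flagAdj hhyp (Finset.mem_union_right A hV) hW
        (fun h : V = W => Finset.disjoint_left.1 hdisj hWA (h ▸ hV))
        fun h => hno ⟨W, hWA, V, hV, h.symm⟩
    · refine le_sup_of_le_left (Finset.le_inf fun V hV => ?_)
      exact hF.inf_erase_le_of_not_flagAdj hhyp (Finset.mem_union_left B hV) hW
        (fun h : V = W => Finset.disjoint_left.1 hdisj hV (h ▸ hWB))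
        fun h => hno ⟨V, hV, W, hWB, h⟩
end

section
/- Let E be an n-dimensional real vector space, ℋ₀ a finite set of linear hyperplanes of E with ⋂ℋ₀ = {0}, and Γ ≤ E a dense subgroup which is free abelian of rank k. Assume that Σ_{V∈f} rk(Γ ∩ V) = (n−1)·k for every flag f ⊆ ℋ₀. Then: (i) if V₁ ∼ V₂ is an edge of the flag graph G(ℋ₀), then rk(Γ ∩ V₁) = rk(Γ ∩ V₂); (ii) consequently, if rk(Γ ∩ V₁) ≠ rk(Γ ∩ V₂) for some V₁, V₂ ∈ ℋ₀, then there is a partition ℋ₀ = A ⊔ B into nonempty subsets with ⋂_{V∈A} V + ⋂_{V∈B} V = E (i.e. ℋ₀ is decomposable). -/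
open scoped Classical

section Hyperplanes

variable {K E : Type*} [Field K] [AddCommGroup E] [Module K E] [FiniteDimensional K E]

open Module

theorem Submodule.exists_dual_ker_eq_of_finrank_add_one {V : Submodule K E}
    (hV : finrank K V + 1 = finrank K E) : ∃ φ : Dual K E, LinearMap.ker φ = V := by
  have hlt : V < ⊤ := by
    refine lt_top_iff_ne_top.2 ?_
    rintro rfl
    rw [finrank_top] at hV
    omega
  obtain ⟨φ, hφ, hle⟩ := V.exists_le_ker_of_lt_top hlt
  refine ⟨φ, (Submodule.eq_of_le_of_finrank_eq hle ?_).symm⟩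
  have := Dual.finrank_ker_add_one_of_ne_zero hφ
  omega

/-- A finite family of hyperplanes contains an independent subfamily with the same
intersection. -/
theorem Submodule.exists_subset_inf_eq_card_add_finrank (H : Finset (Submodule K E))
    (hH : ∀ V ∈ H, finrank K V + 1 = finrank K E) :
    ∃ f ⊆ H, f.inf id = H.inf id ∧
      f.card + finrank K ↥(H.inf id : Submodule K E) = finrank K E := by
  induction H using Finset.induction_on with
  | empty => exact ⟨∅, subset_rfl, rfl, by rw [Finset.inf_empty, finrank_top]; simp⟩
  | insert V H _ ih =>
    obtain ⟨f, hf, hinf, hcard⟩ := ih fun W hW => hH W (Finset.mem_insert_of_mem hW)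
    by_cases hle : H.inf id ≤ V
    · have heq : (insert V H).inf id = H.inf id := by
        rw [Finset.inf_insert]
        exact inf_eq_right.2 hle
      exact ⟨f, hf.trans (Finset.subset_insert _ _), by rw [heq, hinf], by rw [heq, hcard]⟩
    · have hVf : V ∉ f := fun h => hle (hinf ▸ Finset.inf_le (f := id) h)
      refine ⟨insert V f, Finset.insert_subset_insert _ hf, ?_, ?_⟩
      · rw [Finset.inf_insert, Finset.inf_insert, hinf]
      · rw [Finset.card_insert_of_notMem hVf, Finset.inf_insert, id]
        have hV := hH V (Finset.mem_insert_self _ _)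
        have hlt : V < V ⊔ H.inf id := left_lt_sup.2 hle
        have h1 := Submodule.finrank_lt_finrank_of_lt hlt
        have h2 := Submodule.finrank_le (V ⊔ H.inf id)
        have h3 := Submodule.finrank_sup_add_finrank_inf_eq V (H.inf id)
        omega

/-- A maximal independent family of hyperplanes consists of the coordinate hyperplanes of a
basis. -/
theorem Submodule.exists_basis_mem_iff_repr_eq_zero (f : Finset (Submodule K E))
    (hf : ∀ V ∈ f, finrank K V + 1 = finrank K E) (hcard : f.card = finrank K E)
    (hinf : f.inf id = ⊥) :
    ∃ b : Basis f K E, ∀ (x : E) (V : f), x ∈ V.1 ↔ b.repr x V = 0 := by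
  choose φ hφ using fun V : f => exists_dual_ker_eq_of_finrank_add_one (hf V.1 V.2)
  have hmem : ∀ (x : E) (V : f), x ∈ V.1 ↔ φ V x = 0 := fun x V => by
    rw [← LinearMap.mem_ker, hφ]
  have hinj : Function.Injective (LinearMap.pi φ) := by
    rw [← LinearMap.ker_eq_bot, eq_bot_iff]
    intro x hx
    rw [← hinf, Submodule.mem_finsetInf]
    exact fun V hV => (hmem x ⟨V, hV⟩).2 (congrFun hx ⟨V, hV⟩)
  let e : E ≃ₗ[K] (f → K) :=
    LinearEquiv.ofInjectiveOfFinrankEq (LinearMap.pi φ) hinj (by simp [hcard])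
  refine ⟨Basis.ofEquivFun e, fun x V => ?_⟩
  rw [hmem, ← Basis.equivFun_apply, Basis.equivFun_ofEquivFun]
  rfl

end Hyperplanes

section Flags

variable {E : Type*} [AddCommGroup E] [Module ℝ E] {n : ℕ}
  {H0 : Finset (Submodule ℝ E)}

theorem FlagAdj.apply_eq_of_sum_eq {r : Submodule ℝ E → ℕ} {c : ℕ}
    (hC : ∀ f, IsFlag n H0 f → ∑ V ∈ f, r V = c) {V₁ V₂ : Submodule ℝ E}
    (h : FlagAdj n H0 V₁ V₂) : r V₁ = r V₂ := by
  obtain ⟨-, f, h1, h2, hf1, hf2⟩ := h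
  have e1 := hC _ hf1
  have e2 := hC _ hf2
  rw [Finset.sum_insert h1] at e1
  rw [Finset.sum_insert h2] at e2
  omega

/-- A function that is constant along the edges of the flag graph but not constant on `H0`
decomposes `H0`. -/
theorem exists_decomposition_of_flagAdj_apply_eq [FiniteDimensional ℝ E]
    (hn : Module.finrank ℝ E = n) (hH0 : ∀ V ∈ H0, Module.finrank ℝ V + 1 = n)
    (hint : H0.inf id = ⊥) {α : Type*} {r : Submodule ℝ E → α}
    (hr : ∀ V₁ V₂, FlagAdj n H0 V₁ V₂ → r V₁ = r V₂)
    {V₁ V₂ : Submodule ℝ E} (hV₁ : V₁ ∈ H0) (hV₂ : V₂ ∈ H0) (hne : r V₁ ≠ r V₂) :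
    ∃ A B : Finset (Submodule ℝ E), A ∪ B = H0 ∧ Disjoint A B ∧
      A.Nonempty ∧ B.Nonempty ∧ A.inf id ⊔ B.inf id = ⊤ := by
  subst hn
  obtain ⟨f, hfH, hinf, hcard⟩ := Submodule.exists_subset_inf_eq_card_add_finrank H0 hH0
  rw [hint] at hinf
  rw [hint, finrank_bot, add_zero] at hcard
  obtain ⟨b, hb⟩ := Submodule.exists_basis_mem_iff_repr_eq_zero f
    (fun V hV => hH0 V (hfH hV)) hcard hinf
  have basis_mem : ∀ V ∈ H0, ∀ W : f, r W ≠ r V → b W ∈ V := by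
    intro V hV W hWV
    by_contra hmem
    have hVf : V ∉ f := by
      intro hVf
      refine hmem ((hb (b W) ⟨V, hVf⟩).2 ?_)
      rw [b.repr_self, Finsupp.single_eq_of_ne]
      rintro rfl
      exact hWV rfl
    have hVe : V ∉ f.erase W := fun h => hVf (Finset.mem_of_mem_erase h)
    refine hWV (hr W V ⟨fun h => hWV (congrArg r h), f.erase W, Finset.notMem_erase _ _, hVe,
      ?_, ?_⟩)
    · rw [Finset.insert_erase W.2]
      exact ⟨hfH, hcard, hinf⟩
    · refine ⟨Finset.insert_subset hV ((Finset.erase_subset _ _).trans hfH), ?_, ?_⟩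
      · rw [Finset.card_insert_of_notMem hVe, Finset.card_erase_add_one W.2, hcard]
      · rw [eq_bot_iff]
        intro y hy
        rw [Submodule.mem_finsetInf] at hy
        have hyb : y = b.repr y W • b W := by
          conv_lhs => rw [← b.sum_repr y]
          refine Finset.sum_eq_single W (fun U _ hU => ?_) (by simp)
          rw [(hb y U).1 (hy U (Finset.mem_insert_of_mem
            (Finset.mem_erase.2 ⟨fun h => hU (Subtype.ext h), U.2⟩))), zero_smul]
        have hyV : y ∈ V := hy V (Finset.mem_insert_self _ _)
        rw [hyb] at hyV ⊢
        by_cases h0 : b.repr y W = 0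
        · rw [h0, zero_smul]
          exact zero_mem _
        · exact absurd ((V.smul_mem_iff h0).1 hyV) hmem
  refine ⟨H0.filter (r · = r V₁), H0.filter (¬ r · = r V₁), Finset.filter_union_filter_not_eq _ _,
    Finset.disjoint_filter_filter_not _ _ _, ⟨V₁, by simp [hV₁]⟩, ⟨V₂, by simp [hV₂, hne.symm]⟩, ?_⟩
  rw [eq_top_iff, ← b.span_eq, Submodule.span_le]
  rintro _ ⟨W, rfl⟩
  by_cases hW : r W = r V₁
  · refine Submodule.mem_sup_right ((Submodule.mem_finsetInf).2 fun V hV => ?_)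
    rw [Finset.mem_filter] at hV
    exact basis_mem V hV.1 W fun h => hV.2 (h ▸ hW)
  · refine Submodule.mem_sup_left ((Submodule.mem_finsetInf).2 fun V hV => ?_)
    rw [Finset.mem_filter] at hV
    exact basis_mem V hV.1 W fun h => hW (h.trans hV.2)

end Flags

/-- Under minimal complexity (`Σ_{V∈f} rk(Γ∩V) = (n−1)k` for every flag):
(i) adjacent hyperplanes in the flag graph have equal stabiliser ranks;
(ii) if two hyperplanes of `ℋ₀` have different ranks then `ℋ₀` is decomposable. -/
theorem stmt_4 (n k : ℕ) (hn : 1 ≤ n)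
    (Γ : AddSubgroup (Fin n → ℝ)) (hdense : Dense (Γ : Set (Fin n → ℝ)))
    [Module.Free ℤ ↥Γ] [Module.Finite ℤ ↥Γ] (hΓ : Module.finrank ℤ ↥Γ = k)
    (H0 : Finset (Submodule ℝ (Fin n → ℝ)))
    (hhyp : ∀ V ∈ H0, Module.finrank ℝ ↥V = n - 1)
    (hint : H0.inf id = ⊥)
    (hC : ∀ f : Finset (Submodule ℝ (Fin n → ℝ)), IsFlag n H0 f →
      ∑ V ∈ f, Module.finrank ℤ ↥(Γ ⊓ V.toAddSubgroup) = (n - 1) * k) :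
    (∀ V₁ V₂ : Submodule ℝ (Fin n → ℝ), FlagAdj n H0 V₁ V₂ →
      Module.finrank ℤ ↥(Γ ⊓ V₁.toAddSubgroup) =
        Module.finrank ℤ ↥(Γ ⊓ V₂.toAddSubgroup)) ∧
    ((∃ V₁ ∈ H0, ∃ V₂ ∈ H0,
        Module.finrank ℤ ↥(Γ ⊓ V₁.toAddSubgroup) ≠
          Module.finrank ℤ ↥(Γ ⊓ V₂.toAddSubgroup)) →
      ∃ A B : Finset (Submodule ℝ (Fin n → ℝ)), A ∪ B = H0 ∧ Disjoint A B ∧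
        A.Nonempty ∧ B.Nonempty ∧ A.inf id ⊔ B.inf id = ⊤) := by
  have hadj : ∀ V₁ V₂ : Submodule ℝ (Fin n → ℝ), FlagAdj n H0 V₁ V₂ →
      Module.finrank ℤ ↥(Γ ⊓ V₁.toAddSubgroup) =
        Module.finrank ℤ ↥(Γ ⊓ V₂.toAddSubgroup) := fun V₁ V₂ h =>
    h.apply_eq_of_sum_eq (r := fun V => Module.finrank ℤ ↥(Γ ⊓ V.toAddSubgroup)) hC
  refine ⟨hadj, fun ⟨V₁, hV₁, V₂, hV₂, hne⟩ => ?_⟩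
  exact exists_decomposition_of_flagAdj_apply_eq
    (r := fun V => Module.finrank ℤ ↥(Γ ⊓ V.toAddSubgroup)) (by simp)
    (fun V hV => by rw [hhyp V hV]; omega) hint hadj hV₁ hV₂ hne
end

section
/- Let E be an n-dimensional real vector space and ℋ₀ a finite set of linear hyperplanes of E with ⋂ℋ₀ = {0}. (1) Suppose {X₁,…,X_m} is a decomposition of ℋ₀ in the subspace sense. For each i define A_i = {V ∈ ℋ₀ : V ⊇ X_i}. Then {A₁,…,A_m} is a nontrivial copartition of ℋ₀ and E = Y₁ + ⋯ + Y_m where Y_i = ⋂_{V∈A_i} V (i.e. {A_i} is a decomposition in the copartition sense). (2) Conversely, suppose {A₁,…,A_m} (m ≥ 2) is a nontrivial copartition of ℋ₀ such that E = X₁ + ⋯ + X_m where X_i = ⋂_{V∈A_i} V. Then {X₁,…,X_m} is a decomposition of ℋ₀ in the subspace sense. -/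
open scoped Classical

/-- A decomposition of `ℋ₀` in the subspace sense: at least two subspaces, each nontrivial
and proper, forming an internal direct sum of `E`, such that every `V ∈ ℋ₀` contains all
but exactly one of them. -/
def IsSubspaceDecomp {E : Type*} [AddCommGroup E] [Module ℝ E]
    (H0 : Finset (Submodule ℝ E)) {ι : Type*} [Fintype ι] [DecidableEq ι]
    (X : ι → Submodule ℝ E) : Prop :=
  2 ≤ Fintype.card ι ∧ (∀ i, X i ≠ ⊥ ∧ X i ≠ ⊤) ∧ DirectSum.IsInternal X ∧
    ∀ V ∈ H0, ∃! i, ¬ X i ≤ V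

/-- A copartition of `ℋ₀`: every `V ∈ ℋ₀` lies in all but exactly one of the `A i`. -/
def IsCopartition {E : Type*} [AddCommGroup E] [Module ℝ E]
    (H0 : Finset (Submodule ℝ E)) {ι : Type*}
    (A : ι → Finset (Submodule ℝ E)) : Prop :=
  (∀ i, A i ⊆ H0) ∧ ∀ V ∈ H0, ∃! i, V ∉ A i

section Decomposition

variable {E : Type*} [AddCommGroup E] [Module ℝ E] {H0 : Finset (Submodule ℝ E)}
  {ι : Type*}

/-- The members of `H0` containing the summands of a decomposition form a copartition. -/
lemma IsSubspaceDecomp.isCopartition_filter [Fintype ι] [DecidableEq ι]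
    {X : ι → Submodule ℝ E} (hX : IsSubspaceDecomp H0 X) :
    IsCopartition H0 (fun i => H0.filter (fun V => X i ≤ V)) := by
  refine ⟨fun i => Finset.filter_subset _ _, fun V hV => ?_⟩
  simpa [hV] using hX.2.2.2 V hV

lemma IsSubspaceDecomp.filter_ne [Fintype ι] [DecidableEq ι]
    {X : ι → Submodule ℝ E} (hX : IsSubspaceDecomp H0 X) (hint : H0.inf id = ⊥) (i : ι) :
    H0.filter (fun V => X i ≤ V) ≠ ∅ ∧ H0.filter (fun V => X i ≤ V) ≠ H0 := by
  obtain ⟨hcard, hne, -, huniq⟩ := hX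
  have exists_not_le (j : ι) : ∃ V ∈ H0, ¬ X j ≤ V := by
    by_contra! h
    exact (hne j).1 (le_bot_iff.mp (hint ▸ Finset.le_inf h))
  constructor
  · intro h
    have : Nontrivial ι := Fintype.one_lt_card_iff_nontrivial.mp hcard
    obtain ⟨j, hj⟩ := exists_ne i
    obtain ⟨V, hV, hjV⟩ := exists_not_le j
    exact hj ((huniq V hV).unique hjV (Finset.filter_eq_empty_iff.mp h hV))
  · intro h
    obtain ⟨V, hV, hiV⟩ := exists_not_le i
    exact hiV (Finset.filter_eq_self.mp h V hV)

lemma IsSubspaceDecomp.iSup_inf_filter [Fintype ι] [DecidableEq ι]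
    {X : ι → Submodule ℝ E} (hX : IsSubspaceDecomp H0 X) :
    (⨆ i, (H0.filter (fun V => X i ≤ V)).inf id) = ⊤ :=
  top_le_iff.mp <| hX.2.2.1.submodule_iSup_eq_top.ge.trans <|
    iSup_mono fun _ => Finset.le_inf fun _ hV => (Finset.mem_filter.mp hV).2

/-- If `H0` has trivial intersection, the intersections of the members of a copartition of `H0`
are independent. -/
lemma IsCopartition.iSupIndep_inf {A : ι → Finset (Submodule ℝ E)}
    (hA : IsCopartition H0 A) (hint : H0.inf id = ⊥) :
    iSupIndep (fun i => ((A i).inf id : Submodule ℝ E)) := by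
  intro i
  rw [disjoint_iff_inf_le, ← hint]
  refine Finset.le_inf fun V hV => ?_
  by_cases hi : V ∈ A i
  · exact inf_le_left.trans (Finset.inf_le hi)
  · refine inf_le_right.trans (iSup₂_le fun j hj => Finset.inf_le ?_)
    by_contra hjV
    exact hj ((hA.2 V hV).unique hjV hi)

/-- If the intersections of the members of a copartition span, the member omitting a proper
subspace `V ∈ H0` has intersection not contained in `V`. -/
lemma IsCopartition.not_inf_le {A : ι → Finset (Submodule ℝ E)} (hA : IsCopartition H0 A)
    (hsup : (⨆ i, ((A i).inf id : Submodule ℝ E)) = ⊤) {V : Submodule ℝ E} (hV : V ∈ H0)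
    (hVtop : V ≠ ⊤) {i : ι} (hi : V ∉ A i) : ¬ (A i).inf id ≤ V := by
  intro hle
  refine hVtop (top_le_iff.mp (hsup ▸ iSup_le fun j => ?_))
  by_cases hj : V ∈ A j
  · exact Finset.inf_le hj
  · exact (hA.2 V hV).unique hj hi ▸ hle

/-- A nontrivial copartition whose intersections span yields a decomposition. -/
lemma IsCopartition.isSubspaceDecomp_inf [Fintype ι] [DecidableEq ι]
    {A : ι → Finset (Submodule ℝ E)} (hA : IsCopartition H0 A) (hcard : 2 ≤ Fintype.card ι)
    (htop : ∀ V ∈ H0, V ≠ ⊤) (hint : H0.inf id = ⊥) (hne : ∀ i, A i ≠ ∅ ∧ A i ≠ H0)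
    (hsup : (⨆ i, ((A i).inf id : Submodule ℝ E)) = ⊤) :
    IsSubspaceDecomp H0 (fun i => (A i).inf id) := by
  refine ⟨hcard, fun i => ⟨fun h => ?_, fun h => ?_⟩,
    (DirectSum.isInternal_submodule_iff_iSupIndep_and_iSup_eq_top _).mpr
      ⟨hA.iSupIndep_inf hint, hsup⟩, fun V hV => ?_⟩
  · obtain ⟨V, hV, hi⟩ := Finset.exists_of_ssubset ((hA.1 i).ssubset_of_ne (hne i).2)
    exact hA.not_inf_le hsup hV (htop V hV) hi (h.trans_le bot_le)
  · obtain ⟨V, hV⟩ := Finset.nonempty_iff_ne_empty.mpr (hne i).1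
    exact htop V (hA.1 i hV) (top_le_iff.mp (h.ge.trans (Finset.inf_le hV)))
  · obtain ⟨i, hi, huniq⟩ := hA.2 V hV
    exact ⟨i, hA.not_inf_le hsup hV (htop V hV) hi,
      fun j hj => huniq j fun hjV => hj (Finset.inf_le hjV)⟩

end Decomposition

/-- Equivalence of the subspace-sense and copartition-sense notions of a
decomposition of `ℋ₀`. -/
theorem stmt_5 (n m : ℕ) (hn : 1 ≤ n) (hm : 2 ≤ m)
    (E : Type*) [AddCommGroup E] [Module ℝ E] (hE : Module.finrank ℝ E = n)
    (H0 : Finset (Submodule ℝ E))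
    (hhyp : ∀ V ∈ H0, Module.finrank ℝ ↥V = n - 1)
    (hint : H0.inf id = ⊥) :
    (∀ X : Fin m → Submodule ℝ E, IsSubspaceDecomp H0 X →
      IsCopartition H0 (fun i => H0.filter (fun V => X i ≤ V)) ∧
      (∀ i, H0.filter (fun V => X i ≤ V) ≠ ∅ ∧ H0.filter (fun V => X i ≤ V) ≠ H0) ∧
      (⨆ i, (H0.filter (fun V => X i ≤ V)).inf id) = ⊤) ∧
    (∀ A : Fin m → Finset (Submodule ℝ E), IsCopartition H0 A →
      (∀ i, A i ≠ ∅ ∧ A i ≠ H0) →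
      (⨆ i, ((A i).inf id : Submodule ℝ E)) = ⊤ →
      IsSubspaceDecomp H0 (fun i => (A i).inf id)) := by
  have htop : ∀ V ∈ H0, V ≠ ⊤ := by
    rintro V hV rfl
    have h := hhyp _ hV
    rw [finrank_top, hE] at h
    omega
  exact ⟨fun X hX => ⟨hX.isCopartition_filter, hX.filter_ne hint, hX.iSup_inf_filter⟩,
    fun A hA hne hsup => hA.isSubspaceDecomp_inf (by simpa using hm) htop hint hne hsup⟩
end

section
/- Let E be an n-dimensional real vector space, ℋ₀ a finite set of linear hyperplanes of E with ⋂ℋ₀ = {0}, let {X₁,…,X_m} be a decomposition of ℋ₀ in the subspace sense, and let f ⊆ ℋ₀ be a flag. For each i let X_i^f be the intersection of those V ∈ f with V ⊇ X_i. Then X_i^f = X_i for every i, and the number of elements V of f with V ⊇ X_i equals n − dim(X_i). -/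
open scoped Classical

/-- An intersection of `k` subspaces of codimension at most one has codimension at most `k`. -/
theorem finrank_le_finrank_finset_inf_add_card {K E : Type*} [DivisionRing K] [AddCommGroup E]
    [Module K E] [FiniteDimensional K E] (s : Finset (Submodule K E))
    (hs : ∀ V ∈ s, Module.finrank K E ≤ Module.finrank K V + 1) :
    Module.finrank K E ≤ Module.finrank K ↥(s.inf id) + s.card := by
  induction s using Finset.induction_on with
  | empty => rw [Finset.inf_empty, finrank_top, Finset.card_empty, add_zero]
  | insert V s hV ih =>
    have hs' := ih fun W hW => hs W (Finset.mem_insert_of_mem hW)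
    have hV' := hs V (Finset.mem_insert_self V s)
    have hdim := Submodule.finrank_sup_add_finrank_inf_eq V (s.inf id)
    have hsup := Submodule.finrank_le (V ⊔ s.inf id)
    rw [Finset.inf_insert, Finset.card_insert_of_notMem hV, id]
    omega

/-- For a decomposition `{X_i}` of `ℋ₀` and a flag `f ⊆ ℋ₀`, intersecting
only the elements of `f` containing `X_i` recovers `X_i`, and the number of elements of
`f` containing `X_i` is `n − dim(X_i)`. -/
theorem stmt_6 (n m : ℕ) (hn : 1 ≤ n)
    (E : Type*) [AddCommGroup E] [Module ℝ E] (hE : Module.finrank ℝ E = n)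
    (H0 : Finset (Submodule ℝ E))
    (hhyp : ∀ V ∈ H0, Module.finrank ℝ ↥V = n - 1)
    (hint : H0.inf id = ⊥)
    (X : Fin m → Submodule ℝ E) (hX : IsSubspaceDecomp H0 X)
    (f : Finset (Submodule ℝ E)) (hfsub : f ⊆ H0) (hfcard : f.card = n)
    (hfflag : f.inf id = ⊥) :
    ∀ i, (f.filter (fun V => X i ≤ V)).inf id = X i ∧
      (f.filter (fun V => X i ≤ V)).card = n - Module.finrank ℝ ↥(X i) := by
  obtain ⟨-, -, hsum, huniq⟩ := hX
  have : FiniteDimensional ℝ E := Module.finite_of_finrank_pos (by omega)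
  intro i
  set g := f.filter (fun V => X i ≤ V) with hg
  set h := f.filter (fun V => ¬ X i ≤ V) with hh
  have hcard : g.card + h.card = n := by
    rw [← hfcard]; exact Finset.card_filter_add_card_filter_not _
  have hinf : g.inf id ⊓ h.inf id = ⊥ := by
    rw [← Finset.inf_union, hg, hh, Finset.filter_union_filter_not_eq, hfflag]
  have hle : X i ≤ g.inf id := Finset.le_inf fun V hV => (Finset.mem_filter.1 hV).2
  have hcompl : (⨆ j, ⨆ _ : j ≠ i, X j) ≤ h.inf id := by
    refine iSup₂_le fun j hj => Finset.le_inf fun V hV => ?_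
    obtain ⟨hVf, hVi⟩ := Finset.mem_filter.1 hV
    by_contra hVj
    exact hj ((huniq V (hfsub hVf)).unique hVj hVi)
  have htop : X i ⊔ h.inf id = ⊤ := by
    rw [eq_top_iff, ← hsum.submodule_iSup_eq_top]
    refine iSup_le fun j => ?_
    by_cases hj : j = i
    · exact hj ▸ le_sup_left
    · exact (le_iSup₂_of_le j hj le_rfl).trans (hcompl.trans le_sup_right)
  have heq : g.inf id = X i := by
    have hmod := sup_inf_assoc_of_le (h.inf id) hle
    rw [htop, top_inf_eq, inf_comm (h.inf id), hinf, sup_bot_eq] at hmod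
    exact hmod
  refine ⟨heq, ?_⟩
  have hbound : ∀ s ⊆ f, n ≤ Module.finrank ℝ ↥(s.inf id) + s.card := fun s hs => by
    rw [← hE]
    refine finrank_le_finrank_finset_inf_add_card s fun V hV => ?_
    rw [hhyp V (hfsub (hs hV))]
    omega
  have hg_bound := hbound g (Finset.filter_subset _ _)
  have hh_bound := hbound h (Finset.filter_subset _ _)
  have hdim := Submodule.finrank_sup_add_finrank_inf_eq (g.inf id) (h.inf id)
  rw [hinf, finrank_bot] at hdim
  have hsup := Submodule.finrank_le (g.inf id ⊔ h.inf id)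
  rw [heq] at hg_bound hdim hsup
  omega
end

section
/- Let E be an n-dimensional real vector space and ℋ₀ a finite set of linear hyperplanes of E with ⋂ℋ₀ = {0}. Let X = {X₁,…,X_q} and Y = {Y₁,…,Y_r} be two decompositions of ℋ₀ in the subspace sense. Then the collection Z = {X_i ∩ Y_j : 1 ≤ i ≤ q, 1 ≤ j ≤ r, X_i ∩ Y_j ≠ {0}} is again a decomposition of ℋ₀ in the subspace sense, and every element of Z is contained in an element of X and in an element of Y (so any two decompositions have a common refinement). -/
open scoped Classical

namespace Submodule

variable {R E ι κ : Type*} [Ring R] [AddCommGroup E] [Module R E]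

theorem exists_sum_eq_of_iSup_eq_top [Fintype ι] {p : ι → Submodule R E} (h : iSup p = ⊤)
    (x : E) : ∃ c : ι → E, (∀ i, c i ∈ p i) ∧ ∑ i, c i = x := by
  obtain ⟨f, hf⟩ := (mem_iSup_iff_exists_dfinsupp' p x).1 (h ▸ mem_top)
  refine ⟨fun i => f i, fun i => (f i).2, ?_⟩
  rw [← hf, DFinsupp.sum_eq_sum_fintype _ fun _ => rfl]
  rfl

/-- If a submodule `V` contains all but at most one of the `p i`, then it contains every
component of each of its elements. -/
theorem component_mem_of_sum_mem [Fintype ι] {p : ι → Submodule R E} {V : Submodule R E}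
    {i₀ : ι} (hV : ∀ i, i ≠ i₀ → p i ≤ V) {c : ι → E} (hc : ∀ i, c i ∈ p i)
    (hx : ∑ i, c i ∈ V) (i : ι) : c i ∈ V := by
  by_cases h : i = i₀
  · subst h
    rw [← Finset.add_sum_erase _ _ (Finset.mem_univ i)] at hx
    exact (V.add_mem_iff_left (V.sum_mem fun k hk =>
      hV k (Finset.ne_of_mem_erase hk) (hc k))).1 hx
  · exact hV i h (hc i)

theorem iSupIndep_inf_prod [Fintype ι] [Fintype κ] {p : ι → Submodule R E}
    {q : κ → Submodule R E} (hp : iSupIndep p) (hq : iSupIndep q) :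
    iSupIndep fun a : ι × κ => p a.1 ⊓ q a.2 := by
  rw [iSupIndep_iff_finsetSum_eq_zero_imp_eq_zero] at hp hq ⊢
  intro s v hv hsum a ha
  set w : ι × κ → E := fun b => if b ∈ s then v b else 0 with hw
  have hwmem : ∀ b, w b ∈ p b.1 ⊓ q b.2 := by
    intro b
    by_cases hb : b ∈ s
    · simpa only [hw, if_pos hb] using hv b hb
    · simp only [hw, if_neg hb, zero_mem]
  have hwsum : ∑ i, ∑ j, w (i, j) = 0 := by
    rw [← Fintype.sum_prod_type, ← hsum]
    simp [hw]
  have hrow := hp Finset.univ (fun i => ∑ j, w (i, j))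
    (fun i _ => Submodule.sum_mem _ fun j _ => (hwmem (i, j)).1) hwsum
  have := hq Finset.univ (fun j => w (a.1, j)) (fun j _ => (hwmem (a.1, j)).2)
    (hrow a.1 (Finset.mem_univ _)) a.2 (Finset.mem_univ _)
  simpa [hw, ha] using this

end Submodule

namespace IsSubspaceDecomp

variable {E ι κ : Type*} [AddCommGroup E] [Module ℝ E] {H0 : Finset (Submodule ℝ E)}
  [Fintype ι] [DecidableEq ι] [Fintype κ] [DecidableEq κ]
  {X : ι → Submodule ℝ E} {Y : κ → Submodule ℝ E}

theorem iSupIndep (hX : IsSubspaceDecomp H0 X) : iSupIndep X :=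
  hX.2.2.1.submodule_iSupIndep

theorem iSup_eq_top (hX : IsSubspaceDecomp H0 X) : iSup X = ⊤ :=
  hX.2.2.1.submodule_iSup_eq_top

theorem component_mem (hX : IsSubspaceDecomp H0 X) {V : Submodule ℝ E} (hV : V ∈ H0)
    {c : ι → E} (hc : ∀ i, c i ∈ X i) (hx : ∑ i, c i ∈ V) (i : ι) : c i ∈ V := by
  obtain ⟨i₀, -, hi₀⟩ := hX.2.2.2 V hV
  exact Submodule.component_mem_of_sum_mem
    (fun k hk => not_not.1 fun h => hk (hi₀ k h)) hc hx i

/-- Each member of a decomposition is the intersection of the hyperplanes containing it. -/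
theorem mem_of_forall_mem (hint : H0.inf id = ⊥) (hX : IsSubspaceDecomp H0 X) {i : ι} {x : E}
    (hx : ∀ V ∈ H0, X i ≤ V → x ∈ V) : x ∈ X i := by
  obtain ⟨c, hc, rfl⟩ := Submodule.exists_sum_eq_of_iSup_eq_top hX.iSup_eq_top x
  have hzero : ∀ k, k ≠ i → c k = 0 := by
    intro k hk
    rw [← Submodule.mem_bot ℝ, ← hint, Submodule.mem_finsetInf]
    intro V hV
    by_cases hkV : X k ≤ V
    · exact hkV (hc k)
    · have hiV : X i ≤ V := not_not.1 fun h => hk ((hX.2.2.2 V hV).unique hkV h)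
      exact hX.component_mem hV hc (hx V hV hiV) k
  rw [Fintype.sum_eq_single i hzero]
  exact hc i

theorem component_mem_of_decomp (hint : H0.inf id = ⊥) (hX : IsSubspaceDecomp H0 X)
    (hY : IsSubspaceDecomp H0 Y) {i : ι} {c : κ → E} (hc : ∀ j, c j ∈ Y j)
    (hx : ∑ j, c j ∈ X i) (j : κ) : c j ∈ X i :=
  hX.mem_of_forall_mem hint fun _ hV hXV => hY.component_mem hV hc (hXV hx) j

theorem iSup_inf_eq_top (hint : H0.inf id = ⊥) (hX : IsSubspaceDecomp H0 X)
    (hY : IsSubspaceDecomp H0 Y) :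
    ⨆ a : {a : ι × κ // X a.1 ⊓ Y a.2 ≠ ⊥}, X a.val.1 ⊓ Y a.val.2 = ⊤ := by
  rw [eq_top_iff, ← hX.iSup_eq_top]
  refine iSup_le fun i x hx => ?_
  obtain ⟨c, hc, rfl⟩ := Submodule.exists_sum_eq_of_iSup_eq_top hY.iSup_eq_top x
  refine Submodule.sum_mem _ fun j _ => ?_
  have hmem : c j ∈ X i ⊓ Y j := ⟨hX.component_mem_of_decomp hint hY hc hx j, hc j⟩
  by_cases h : X i ⊓ Y j = ⊥
  · rw [h, Submodule.mem_bot] at hmem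
    exact hmem ▸ zero_mem _
  · exact Submodule.mem_iSup_of_mem
      (p := fun a : {a : ι × κ // X a.1 ⊓ Y a.2 ≠ ⊥} => X a.val.1 ⊓ Y a.val.2)
      ⟨(i, j), h⟩ hmem

theorem inf (hint : H0.inf id = ⊥) (hX : IsSubspaceDecomp H0 X) (hY : IsSubspaceDecomp H0 Y)
    [Fintype {a : ι × κ // X a.1 ⊓ Y a.2 ≠ ⊥}]
    [DecidableEq {a : ι × κ // X a.1 ⊓ Y a.2 ≠ ⊥}] :
    IsSubspaceDecomp H0
      (fun a : {a : ι × κ // X a.1 ⊓ Y a.2 ≠ ⊥} => X a.val.1 ⊓ Y a.val.2) := by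
  have htop := hX.iSup_inf_eq_top hint hY
  have hne_top : ∀ a : {a : ι × κ // X a.1 ⊓ Y a.2 ≠ ⊥}, X a.val.1 ⊓ Y a.val.2 ≠ ⊤ :=
    fun a h => (hX.2.1 a.val.1).2 (inf_eq_top_iff.1 h).1
  refine ⟨?_, fun a => ⟨a.2, hne_top a⟩, ?_, fun V hV => ?_⟩
  · by_contra! hcard
    have := Fintype.card_le_one_iff_subsingleton.1 (Nat.le_of_lt_succ hcard)
    have : Nonempty ι := Fintype.card_pos_iff.1 (zero_lt_two.trans_le hX.1)
    obtain ⟨i⟩ := this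
    rcases isEmpty_or_nonempty {a : ι × κ // X a.1 ⊓ Y a.2 ≠ ⊥} with _ | ⟨⟨a⟩⟩
    · rw [iSup_of_empty] at htop
      exact (hX.2.1 i).1 (le_bot_iff.1 (htop ▸ le_top))
    · rw [ciSup_subsingleton a] at htop
      exact hne_top a htop
  · exact (DirectSum.isInternal_submodule_iff_iSupIndep_and_iSup_eq_top _).2
      ⟨(Submodule.iSupIndep_inf_prod hX.iSupIndep hY.iSupIndep).comp
        Subtype.val_injective, htop⟩
  · have hex : ∃ a : {a : ι × κ // X a.1 ⊓ Y a.2 ≠ ⊥}, ¬ X a.val.1 ⊓ Y a.val.2 ≤ V := by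
      by_contra! hle
      obtain ⟨i, hi, -⟩ := hX.2.2.2 V hV
      exact hi (le_top.trans (htop ▸ iSup_le hle))
    obtain ⟨a, ha⟩ := hex
    refine ⟨a, ha, fun b hb => Subtype.ext (Prod.ext ?_ ?_)⟩
    · exact (hX.2.2.2 V hV).unique (fun h => hb (inf_le_left.trans h))
        (fun h => ha (inf_le_left.trans h))
    · exact (hY.2.2.2 V hV).unique (fun h => hb (inf_le_right.trans h))
        (fun h => ha (inf_le_right.trans h))

end IsSubspaceDecomp

/-- Two decompositions `X = {X_i}` and `Y = {Y_j}` of `ℋ₀` have the common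
refinement `Z = {X_i ∩ Y_j ≠ {0}}`, which is again a decomposition, each of whose members
is contained in a member of `X` and in a member of `Y`. -/
theorem stmt_7 (n q r : ℕ) (hn : 1 ≤ n)
    (E : Type*) [AddCommGroup E] [Module ℝ E] (hE : Module.finrank ℝ E = n)
    (H0 : Finset (Submodule ℝ E))
    (hhyp : ∀ V ∈ H0, Module.finrank ℝ ↥V = n - 1)
    (hint : H0.inf id = ⊥)
    (X : Fin q → Submodule ℝ E) (hX : IsSubspaceDecomp H0 X)
    (Y : Fin r → Submodule ℝ E) (hY : IsSubspaceDecomp H0 Y) :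
    IsSubspaceDecomp H0
      (fun p : {p : Fin q × Fin r // X p.1 ⊓ Y p.2 ≠ ⊥} => X p.val.1 ⊓ Y p.val.2) ∧
    ∀ p : {p : Fin q × Fin r // X p.1 ⊓ Y p.2 ≠ ⊥},
      (∃ i, X p.val.1 ⊓ Y p.val.2 ≤ X i) ∧ (∃ j, X p.val.1 ⊓ Y p.val.2 ≤ Y j) := by
  exact ⟨hX.inf hint hY, fun p => ⟨⟨p.val.1, inf_le_left⟩, ⟨p.val.2, inf_le_right⟩⟩⟩
end

section
/- Let W ⊂ ℝ^n be a compact convex polytope with nonempty interior, written as W = ⋂_{H⁺ ∈ ℋ⁺} H⁺ where ℋ⁺ is the unique irredundant finite set of closed half-spaces with this intersection (irredundant meaning that omitting any one member strictly enlarges the intersection). Let ℋ be the set of boundary hyperplanes of the members of ℋ⁺ (the supporting hyperplanes of W), and ℋ₀ = {H − H : H ∈ ℋ} the corresponding set of linear hyperplanes. Let X₁,…,X_m (m ≥ 2) be linear subspaces of ℝ^n, each different from {0} and from ℝ^n, such that ℝ^n is the internal direct sum X₁ ⊕ ⋯ ⊕ X_m. Then every V ∈ ℋ₀ contains all but exactly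 one of the X_i if and only if there exist compact convex polytopes W_i ⊆ X_i (convex hulls of finite sets) such that W = W₁ + W₂ + ⋯ + W_m (Minkowski sum). -/
open scoped Pointwise

/-- The family of projections onto the summands of an internal direct sum. -/
theorem DirectSum.IsInternal.exists_projections {R ι E : Type*} [CommRing R] [Fintype ι]
    [DecidableEq ι] [AddCommGroup E] [Module R E] {X : ι → Submodule R E}
    (hX : DirectSum.IsInternal X) :
    ∃ p : ι → E →ₗ[R] E, (∀ i x, p i x ∈ X i) ∧ (∀ x, ∑ i, p i x = x) ∧
      (∀ i, ∀ x ∈ X i, p i x = x) ∧ ∀ i j, i ≠ j → ∀ x ∈ X j, p i x = 0 := by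
  classical
  let e := LinearEquiv.ofBijective (DirectSum.coeLinearMap X) hX
  have he (i : ι) (x : X i) : e.symm x = DirectSum.lof R ι (fun i => X i) i x := by
    rw [LinearEquiv.symm_apply_eq]
    exact (DirectSum.coeLinearMap_lof X i x).symm
  refine ⟨fun i => (X i).subtype ∘ₗ DirectSum.component R ι (fun i => X i) i ∘ₗ
    e.symm.toLinearMap, fun i x => by simp, fun x => ?_, fun i x hx => ?_,
    fun i j hij x hx => ?_⟩
  · conv_rhs => rw [← e.apply_symm_apply x]
    change _ = DirectSum.coeLinearMap X (e.symm x)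
    rw [DirectSum.coeLinearMap_eq_dfinsuppSum, DFinsupp.sum_eq_sum_fintype _ (by simp)]
    rfl
  · have := he i ⟨x, hx⟩
    simp only at this
    simp [this, DirectSum.component.lof_self]
  · have := he j ⟨x, hx⟩
    simp only at this
    simp [this, DirectSum.component.of, hij.symm]

section Polyhedron

variable {ι E : Type*} [AddCommGroup E] [Module ℝ E]

/-- A small step in any direction preserves finitely many strict linear inequalities. -/
theorem eventually_forall_apply_add_smul_lt [Finite ι] (ℓ : ι → E →ₗ[ℝ] ℝ) (a : ι → ℝ) (x d : E) :
    ∀ᶠ ε : ℝ in nhds 0, ∀ i, ℓ i x < a i → ℓ i (x + ε • d) < a i := by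
  rw [Filter.eventually_all]
  intro i
  by_cases hi : ℓ i x < a i
  · have hc : Continuous fun ε : ℝ => ℓ i x + ε * ℓ i d := by fun_prop
    have := hc.continuousAt.eventually_lt (x₀ := (0 : ℝ)) (continuousAt_const (y := a i))
      (by simpa using hi)
    filter_upwards [this] with ε hε _
    simpa using hε
  · simp [hi]

/-- A polyhedron has finitely many extreme points, as such a point is determined by the
constraints that are active at it. -/
theorem finite_extremePoints_polyhedron [Finite ι] (ℓ : ι → E →ₗ[ℝ] ℝ) (a : ι → ℝ) :
    ({x | ∀ i, ℓ i x ≤ a i}.extremePoints ℝ).Finite := by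
  refine Set.Finite.of_injOn (f := fun x => {i | ℓ i x = a i}) (t := Set.univ)
    (Set.mapsTo_univ _ _) ?_ Set.finite_univ
  intro x hx y _ hxy
  have hxW := hx.1
  have key : ∀ᶠ ε : ℝ in nhds 0, x + ε • (y - x) ∈ {x | ∀ i, ℓ i x ≤ a i} := by
    filter_upwards [eventually_forall_apply_add_smul_lt ℓ a x (y - x)] with ε hε i
    rcases (hxW i).lt_or_eq with h | h
    · exact (hε i h).le
    · have : ℓ i y = a i := (Set.ext_iff.1 hxy i).1 h
      simp [h, this]
  have keyn : ∀ᶠ ε : ℝ in nhds 0, x + (-ε) • (y - x) ∈ {x | ∀ i, ℓ i x ≤ a i} := by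
    have : Filter.Tendsto (fun ε : ℝ => -ε) (nhds 0) (nhds 0) := by
      simpa using (continuous_neg (G := ℝ)).tendsto 0
    exact this.eventually key
  obtain ⟨ε, ⟨h₁, h₂⟩, hε⟩ :=
    (((key.and keyn).filter_mono nhdsWithin_le_nhds).and
      (self_mem_nhdsWithin (s := Set.Ioi (0 : ℝ)))).exists
  have hmem : x ∈ openSegment ℝ (x + ε • (y - x)) (x + (-ε) • (y - x)) :=
    ⟨1 / 2, 1 / 2, by norm_num, by norm_num, by norm_num, by module⟩
  have := hx.2 h₁ h₂ hmem
  have h0 : ε • (y - x) = 0 := by simpa using this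
  have := (smul_eq_zero.1 h0).resolve_left (ne_of_gt hε)
  exact (sub_eq_zero.1 this).symm

/-- A compact polyhedron is the convex hull of a finite set. -/
theorem exists_finset_convexHull_eq_of_isCompact_polyhedron [Finite ι] [TopologicalSpace E]
    [T2Space E] [IsTopologicalAddGroup E] [ContinuousSMul ℝ E] [LocallyConvexSpace ℝ E]
    (ℓ : ι → E →ₗ[ℝ] ℝ) (a : ι → ℝ) (hc : IsCompact {x | ∀ i, ℓ i x ≤ a i}) :
    ∃ s : Finset E, {x | ∀ i, ℓ i x ≤ a i} = convexHull ℝ (s : Set E) := by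
  have hfin := finite_extremePoints_polyhedron ℓ a
  have hconv : Convex ℝ {x | ∀ i, ℓ i x ≤ a i} := by
    rw [Set.ofPred_forall]
    exact convex_iInter fun i => convex_halfSpace_le (ℓ i).isLinear (a i)
  refine ⟨hfin.toFinset, ?_⟩
  rw [hfin.coe_toFinset]
  have hcl : IsClosed (convexHull ℝ ({x | ∀ i, ℓ i x ≤ a i}.extremePoints ℝ)) :=
    (hfin.isCompact_convexHull (𝕜 := ℝ)).isClosed
  exact (closure_convexHull_extremePoints hc hconv).symm.trans hcl.closure_eq

/-- A nonzero functional bounded on a set is strictly below the bound on the interior. -/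
theorem apply_lt_of_mem_interior [TopologicalSpace E] [ContinuousAdd E] [ContinuousSMul ℝ E]
    {ℓ : E →ₗ[ℝ] ℝ} {a : ℝ} {W : Set E} (hℓ : ℓ ≠ 0) (hW : ∀ x ∈ W, ℓ x ≤ a) {z : E}
    (hz : z ∈ interior W) : ℓ z < a := by
  obtain ⟨v, hv⟩ : ∃ v, ℓ v ≠ 0 := by
    by_contra! h
    exact hℓ (LinearMap.ext h)
  have hc : Continuous fun ε : ℝ => z + ε • (ℓ v • v) := by fun_prop
  have hev : ∀ᶠ ε : ℝ in nhds 0, z + ε • (ℓ v • v) ∈ W :=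
    hc.continuousAt.eventually_mem (by simpa using mem_interior_iff_mem_nhds.1 hz)
  obtain ⟨ε, h₁, hε⟩ :=
    ((hev.filter_mono nhdsWithin_le_nhds).and
      (self_mem_nhdsWithin (s := Set.Ioi (0 : ℝ)))).exists
  have h := hW _ h₁
  simp only [map_add, map_smul, smul_eq_mul] at h
  have : 0 < ε * (ℓ v * ℓ v) := mul_pos hε (mul_self_pos.2 hv)
  linarith

/-- An irredundant constraint is the only active one at some point of the polyhedron. -/
theorem exists_unique_active_of_irredundant (ℓ : ι → E →ₗ[ℝ] ℝ) (a : ι → ℝ) {y z : E} {k : ι}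
    (hz : ∀ i, ℓ i z < a i) (hyk : a k < ℓ k y) (hy : ∀ i, i ≠ k → ℓ i y ≤ a i) :
    ∃ x, ℓ k x = a k ∧ ∀ i, i ≠ k → ℓ i x < a i := by
  have hzk := hz k
  have hpos : 0 < ℓ k y - ℓ k z := by linarith
  let t := (a k - ℓ k z) / (ℓ k y - ℓ k z)
  have ht0 : 0 < t := div_pos (by linarith) hpos
  have ht1 : t < 1 := (div_lt_one hpos).2 (by linarith)
  refine ⟨z + t • (y - z), ?_, fun i hi => ?_⟩
  · simp only [map_add, map_smul, map_sub, smul_eq_mul, t]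
    field_simp
    ring
  · simp only [map_add, map_smul, map_sub, smul_eq_mul]
    nlinarith [hz i, hy i hi, mul_nonneg ht0.le (sub_nonneg.2 (hy i hi)),
      mul_pos (sub_pos.2 ht1) (sub_pos.2 (hz i))]

end Polyhedron

/-- A functional defining a facet of a set closed under exchange of components is nonzero on at
most one component. -/
theorem eq_of_not_le_ker_of_exchange {κ ι E : Type*} [Finite κ] [AddCommGroup E]
    [Module ℝ E] {X : ι → Submodule ℝ E} {p : ι → E →ₗ[ℝ] E}
    (hpX : ∀ i, ∀ x ∈ X i, p i x = x) (hp0 : ∀ i j, i ≠ j → ∀ x ∈ X j, p i x = 0)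
    (ℓ : κ → E →ₗ[ℝ] ℝ) (a : κ → ℝ) {k : κ} {x : E} (hxk : ℓ k x = a k)
    (hx : ∀ i, i ≠ k → ℓ i x < a i)
    (hex : ∀ i x y, (∀ c, ℓ c x ≤ a c) → (∀ c, ℓ c y ≤ a c) →
      ∀ c, ℓ c (x - p i x + p i y) ≤ a c) {i j : ι}
    (hi : ¬ X i ≤ LinearMap.ker (ℓ k)) (hj : ¬ X j ≤ LinearMap.ker (ℓ k)) : i = j := by
  by_contra hij
  obtain ⟨u, hu, hu0⟩ := SetLike.not_le_iff_exists.1 hi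
  obtain ⟨v, hv, hv0⟩ := SetLike.not_le_iff_exists.1 hj
  rw [LinearMap.mem_ker] at hu0 hv0
  set d := ℓ k u • u - ((ℓ k u * ℓ k u) / ℓ k v) • v with hd
  have hdk : ℓ k d = 0 := by
    simp only [hd, map_sub, map_smul, smul_eq_mul]
    field_simp
    ring
  have hpd : p i d = ℓ k u • u := by
    simp [hd, hpX i u hu, hp0 i j hij v hv]
  obtain ⟨ε, h₁, hε⟩ :=
    (((eventually_forall_apply_add_smul_lt ℓ a x d).filter_mono nhdsWithin_le_nhds).and
      (self_mem_nhdsWithin (s := Set.Ioi (0 : ℝ)))).exists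
  have hxW : ∀ c, ℓ c x ≤ a c := fun c => by
    by_cases hc : c = k
    · rw [hc, hxk]
    · exact (hx c hc).le
  have hyW : ∀ c, ℓ c (x + ε • d) ≤ a c := fun c => by
    by_cases hc : c = k
    · simp [hc, hxk, hdk]
    · exact (h₁ c (hx c hc)).le
  have h := hex i x _ hxW hyW k
  simp only [map_add, map_sub, map_smul, hpd, smul_eq_mul, hxk] at h
  have : 0 < ε * (ℓ k u * ℓ k u) := mul_pos hε (mul_self_pos.2 hu0)
  linarith

/-- A Minkowski sum of sets in complementary subspaces is closed under exchange of components. -/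
theorem sub_add_mem_sum_of_projections {R ι E : Type*} [CommRing R] [Fintype ι]
    [AddCommGroup E] [Module R E] {X : ι → Submodule R E} {p : ι → E →ₗ[R] E}
    (hpX : ∀ i, ∀ x ∈ X i, p i x = x) (hp0 : ∀ i j, i ≠ j → ∀ x ∈ X j, p i x = 0)
    {W : ι → Set E} (hW : ∀ i, W i ⊆ X i) (i : ι) {x y : E} (hx : x ∈ ∑ j, W j)
    (hy : y ∈ ∑ j, W j) : x - p i x + p i y ∈ ∑ j, W j := by
  classical
  have hp (i : ι) (f : ι → E) (hf : ∀ j, f j ∈ W j) : p i (∑ j, f j) = f i := by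
    rw [map_sum, Finset.sum_eq_single i]
    · exact hpX i _ (hW i (hf i))
    · exact fun j _ hj => hp0 i j hj.symm _ (hW j (hf j))
    · simp
  rw [Set.mem_fintype_sum] at hx hy ⊢
  obtain ⟨f, hf, rfl⟩ := hx
  obtain ⟨g, hg, rfl⟩ := hy
  rw [hp i f hf, hp i g hg]
  refine ⟨Function.update f i (g i), fun j => ?_, ?_⟩
  · by_cases h : j = i
    · subst h; simpa using hg j
    · simpa [h] using hf j
  · rw [Finset.sum_update_of_mem (Finset.mem_univ i),
      ← Finset.add_sum_erase _ f (Finset.mem_univ i), Finset.sdiff_singleton_eq_erase]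
    abel

/-- If every defining functional of a polyhedron is nonzero on at most one summand, then the
polyhedron is the Minkowski sum of its projections. -/
theorem polyhedron_eq_sum_image {κ ι E : Type*} [Fintype ι] [AddCommGroup E]
    [Module ℝ E] {X : ι → Submodule ℝ E} {p : ι → E →ₗ[ℝ] E} (hp : ∀ i x, p i x ∈ X i)
    (hsum : ∀ x, ∑ i, p i x = x) (ℓ : κ → E →ₗ[ℝ] ℝ) (a : κ → ℝ)
    (h : ∀ c, ∃ i, ∀ j, j ≠ i → X j ≤ LinearMap.ker (ℓ c)) :
    {x | ∀ c, ℓ c x ≤ a c} = ∑ i, p i '' {x | ∀ c, ℓ c x ≤ a c} := by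
  ext x
  rw [Set.mem_fintype_sum]
  constructor
  · exact fun hx => ⟨fun i => p i x, fun i => Set.mem_image_of_mem _ hx, hsum x⟩
  · rintro ⟨f, hf, rfl⟩ c
    obtain ⟨i, hi⟩ := h c
    have hker (f : ι → E) (hf : ∀ j, f j ∈ X j) : ℓ c (∑ j, f j) = ℓ c (f i) := by
      rw [map_sum, Finset.sum_eq_single i]
      · exact fun j _ hj => hi j hj (hf j)
      · simp
    choose w hw hwf using hf
    rw [hker f fun j => hwf j ▸ hp j _, ← hwf i, ← hker (fun j => p j (w i)) (fun j => hp j _),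
      hsum]
    exact hw i c

open scoped Pointwise

/-- For a compact convex polytope `W = ⋂ ℋ⁺` (irredundant finite set of
closed half-spaces) with nonempty interior, and complementary nontrivial proper subspaces
`X₁,…,X_m` giving an internal direct sum of `ℝⁿ`: every supporting subspace of `W`
contains all but exactly one `X_i` iff `W` is a Minkowski sum `W₁ + ⋯ + W_m` of compact
convex polytopes `W_i ⊆ X_i`. -/
theorem stmt_8 (n m : ℕ) (hn : 1 ≤ n) (hm : 2 ≤ m)
    (Hs : Set (Set (Fin n → ℝ))) (hfin : Hs.Finite)
    (hhalf : ∀ h ∈ Hs, ∃ (ℓ : (Fin n → ℝ) →ₗ[ℝ] ℝ) (a : ℝ), ℓ ≠ 0 ∧ h = {x | ℓ x ≤ a})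
    (W : Set (Fin n → ℝ)) (hW : W = ⋂₀ Hs)
    (hcompact : IsCompact W) (hinterior : (interior W).Nonempty)
    (hirr : ∀ h ∈ Hs, W ⊂ ⋂₀ (Hs \ {h}))
    (X : Fin m → Submodule ℝ (Fin n → ℝ))
    (hXnontriv : ∀ i, X i ≠ ⊥ ∧ X i ≠ ⊤)
    (hXsum : DirectSum.IsInternal X) :
    (∀ h ∈ Hs, ∀ (ℓ : (Fin n → ℝ) →ₗ[ℝ] ℝ) (a : ℝ), ℓ ≠ 0 → h = {x | ℓ x ≤ a} →
        ∃! i, ¬ X i ≤ LinearMap.ker ℓ) ↔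
      (∃ W' : Fin m → Set (Fin n → ℝ),
        (∀ i, ∃ s : Finset (Fin n → ℝ),
          (↑s : Set (Fin n → ℝ)) ⊆ (X i : Set (Fin n → ℝ)) ∧ W' i = convexHull ℝ ↑s) ∧
        W = ∑ i, W' i) := by
  obtain ⟨p, hp, hsum, hpX, hp0⟩ := hXsum.exists_projections
  have : Finite Hs := hfin
  choose L b hL0 hLb using fun h : Hs => hhalf h h.2
  have hWeq : W = {x | ∀ c, L c x ≤ b c} := by
    ext x
    rw [hW, Set.mem_sInter]
    refine ⟨fun hx c => ?_, fun hx h hh => ?_⟩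
    · simpa [hLb c] using hx c c.2
    · have := hx ⟨h, hh⟩
      rw [show h = _ from hLb ⟨h, hh⟩]
      exact this
  constructor
  · intro H
    obtain ⟨s, hs⟩ := exists_finset_convexHull_eq_of_isCompact_polyhedron L b (hWeq ▸ hcompact)
    refine ⟨fun i => p i '' W, fun i => ⟨s.image (p i), ?_, ?_⟩, ?_⟩
    · intro x hx
      obtain ⟨y, _, rfl⟩ := Finset.mem_image.1 (Finset.mem_coe.1 hx)
      exact hp i y
    · rw [hWeq, hs, Finset.coe_image]
      exact (p i).image_convexHull _
    · simp only [hWeq]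
      refine polyhedron_eq_sum_image hp hsum L b fun c => ?_
      obtain ⟨i, _, hi⟩ := H c c.2 (L c) (b c) (hL0 c) (hLb c)
      exact ⟨i, fun j hj => by_contra fun hle => hj (hi j hle)⟩
  · rintro ⟨W', hW', hWsum⟩ h hh ℓ a hℓ hha
    classical
    let L' := Function.update L ⟨h, hh⟩ ℓ
    let b' := Function.update b ⟨h, hh⟩ a
    have hLb' (c : Hs) : (c : Set (Fin n → ℝ)) = {x | L' c x ≤ b' c} := by
      by_cases hc : c = ⟨h, hh⟩
      · subst hc
        simpa [L', b'] using hha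
      · simpa [L', b', hc] using hLb c
    have hmem (c : Hs) (x) : x ∈ (c : Set (Fin n → ℝ)) ↔ L' c x ≤ b' c := by
      conv_lhs => rw [hLb' c]
      rfl
    have hWmem (x) : x ∈ W ↔ ∀ c, L' c x ≤ b' c := by
      simp [hW, Set.mem_sInter, ← hmem]
    have hL0' (c : Hs) : L' c ≠ 0 := by
      by_cases hc : c = ⟨h, hh⟩
      · subst hc
        simpa [L'] using hℓ
      · simpa [L', hc] using hL0 c
    obtain ⟨z, hz⟩ := hinterior
    obtain ⟨y, hy, hyW⟩ := Set.exists_of_ssubset (hirr h hh)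
    have hy' (c : Hs) (hc : c ≠ ⟨h, hh⟩) : L' c y ≤ b' c :=
      (hmem c y).1 (hy c ⟨c.2, fun he => hc (Subtype.ext he)⟩)
    have hyk : b' ⟨h, hh⟩ < L' ⟨h, hh⟩ y := by
      by_contra! hle
      refine hyW ((hWmem y).2 fun c => ?_)
      by_cases hc : c = ⟨h, hh⟩
      · exact hc ▸ hle
      · exact hy' c hc
    obtain ⟨x, hxk, hx⟩ := exists_unique_active_of_irredundant L' b'
      (fun c => apply_lt_of_mem_interior (hL0' c) (fun x hx => (hWmem x).1 hx c) hz) hyk hy'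
    have hsub (i) : W' i ⊆ X i := by
      obtain ⟨s, hs, hconv⟩ := hW' i
      rw [hconv]
      exact convexHull_min hs (X i).convex
    have huniq := @eq_of_not_le_ker_of_exchange _ _ _ _ _ _ X p hpX hp0 L' b' _ x hxk hx
      fun i x y hx hy => (hWmem _).1 <| by
        rw [← hWmem, hWsum] at hx hy
        rw [hWsum]
        exact sub_add_mem_sum_of_projections hpX hp0 hsub i hx hy
    simp only [L', Function.update_self] at huniq
    obtain ⟨i, hi⟩ : ∃ i, ¬ X i ≤ LinearMap.ker ℓ := by
      by_contra! hle
      refine hℓ (LinearMap.ext fun v => ?_)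
      rw [← hsum v, map_sum]
      exact Finset.sum_eq_zero fun i _ => hle i (hp i v)
    exact ⟨i, hi, fun j hj => huniq hj hi⟩
end

section
/- Let Γ ≤ ℝ^n be a dense subgroup which is free abelian of rank k, and let ℋ₀ be a finite set of linear hyperplanes of ℝ^n with ⋂ℋ₀ = {0}. Assume that Σ_{V∈f} rk(Γ ∩ V) = (n−1)·k for every flag f ⊆ ℋ₀. Let {A₁,…,A_m} be a nontrivial copartition of ℋ₀ such that ℝ^n = X₁ + ⋯ + X_m, where X_i = ⋂_{V∈A_i} V (i.e. {A_i} is a decomposition), and set Γ_i = Γ ∩ X_i. Then Γ₁ + Γ₂ + ⋯ + Γ_m is a finite index subgroup of Γ. -/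
namespace Submodule

open Module

/-- Codimension is subadditive under finite intersections. -/
theorem finrank_le_finrank_finset_inf_add_sum.{v} {R ι : Type*} {M : Type v} [Ring R]
    [AddCommGroup M] [Module R M] [HasRankNullity.{v} R] [StrongRankCondition R] [IsNoetherian R M]
    (N : ι → Submodule R M) (s : Finset ι) :
    finrank R M ≤ finrank R ↥(s.inf N) + ∑ i ∈ s, (finrank R M - finrank R (N i)) := by
  classical
  induction s using Finset.induction_on with
  | empty => rw [Finset.inf_empty, finrank_top]; exact Nat.le_add_right _ _
  | insert a s ha ih =>
    rw [Finset.inf_insert, Finset.sum_insert ha]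
    have h : finrank R ↥(N a ⊔ s.inf N) + finrank R ↥(N a ⊓ s.inf N) =
        finrank R (N a) + finrank R ↥(s.inf N) := by
      rw [← Nat.cast_inj (R := Cardinal.{v}), Nat.cast_add, Nat.cast_add]
      simpa only [Module.finrank_eq_rank, Submodule.finrank_eq_rank] using
        rank_sup_add_rank_inf_eq (N a) (s.inf N)
    have h1 := finrank_le (R := R) (N a ⊔ s.inf N)
    have h2 := finrank_le (R := R) (N a)
    lia

/-- Among finitely many subspaces of codimension at most one with trivial intersection, there are
`finrank K E` many which already have trivial intersection. -/
theorem exists_subset_card_eq_finrank_inf_eq_bot {K E : Type*} [Field K] [AddCommGroup E]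
    [Module K E] [FiniteDimensional K E] (H : Finset (Submodule K E))
    (hH : ∀ V ∈ H, finrank K E ≤ finrank K V + 1) (hbot : H.inf id = ⊥) :
    ∃ f ⊆ H, f.card = finrank K E ∧ f.inf id = ⊥ := by
  classical
  obtain ⟨f, hfH, hf⟩ := exists_minimal_le_of_wellFoundedLT
    (fun s : Finset (Submodule K E) => s.inf id = ⊥) H hbot
  refine ⟨f, hfH, le_antisymm ?_ ?_, hf.prop⟩
  · have hex : ∀ V : f, ∃ v : E, v ≠ 0 ∧ ∀ W ∈ f, W ≠ V → v ∈ W := by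
      intro V
      have hne : (f.erase V).inf id ≠ ⊥ := fun h =>
        Finset.notMem_erase (V : Submodule K E) f (hf.le_of_le h (Finset.erase_subset _ _) V.2)
      obtain ⟨v, hv, hv0⟩ := exists_mem_ne_zero_of_ne_bot hne
      rw [mem_finsetInf] at hv
      exact ⟨v, hv0, fun W hW hWV => hv W (Finset.mem_erase.2 ⟨hWV, hW⟩)⟩
    choose v hv0 hv using hex
    have hlin : LinearIndependent K v := by
      rw [Fintype.linearIndependent_iff]
      intro g hg V
      have hmem : g V • v V ∈ f.inf id := by
        rw [mem_finsetInf]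
        intro W hW
        by_cases hWV : W = V
        · subst hWV
          rw [← Finset.add_sum_erase _ _ (Finset.mem_univ V)] at hg
          rw [eq_neg_of_add_eq_zero_left hg]
          refine neg_mem (sum_mem fun U hU => smul_mem _ _ (hv U _ V.2 fun h => ?_))
          exact (Finset.mem_erase.1 hU).1 (Subtype.ext h.symm)
        · exact smul_mem _ _ (hv V W hW hWV)
      rw [hf.prop, mem_bot] at hmem
      exact (smul_eq_zero.1 hmem).resolve_right (hv0 V)
    simpa using hlin.fintype_card_le_finrank
  · have h := finrank_le_finrank_finset_inf_add_sum (R := K) (M := E) id f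
    rw [hf.prop, finrank_bot, zero_add] at h
    refine h.trans ((Finset.sum_le_card_nsmul _ _ 1 fun V hV => ?_).trans (by simp))
    have := hH V (hfH hV)
    change finrank K E - finrank K V ≤ 1
    omega

section Copartition

variable {R E ι : Type*} [Ring R] [AddCommGroup E] [Module R E] [Fintype ι]
  {f : Finset (Submodule R E)} {A : ι → Finset (Submodule R E)}

/-- If the complements of the `A i` are disjoint on `f`, and `f` has trivial intersection, then
the intersections of the families `f ∩ A i` are independent. -/
theorem eq_zero_of_sum_eq_zero_of_copartition (hf : f.inf id = ⊥)
    (hA : ∀ V ∈ f, ∃! i, V ∉ A i) {z : ι → E} (hz : ∀ i, ∀ V ∈ f, V ∈ A i → z i ∈ V)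
    (hsum : ∑ i, z i = 0) (i : ι) : z i = 0 := by
  classical
  rw [← mem_bot R, ← hf, mem_finsetInf]
  intro V hV
  by_cases hVi : V ∈ A i
  · exact hz i V hV hVi
  · rw [← Finset.add_sum_erase _ _ (Finset.mem_univ i)] at hsum
    rw [eq_neg_of_add_eq_zero_left hsum]
    refine neg_mem (sum_mem fun j hj => hz j V hV ?_)
    by_contra hVj
    exact (Finset.mem_erase.1 hj).1 ((hA V hV).unique hVj hVi)

/-- In a copartition decomposition, the space `⋂ A i` is already cut out by the members of `A i`
in a subfamily `f` with trivial intersection. -/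
theorem mem_inf_of_copartition (hf : f.inf id = ⊥) (hA : ∀ V ∈ f, ∃! i, V ∉ A i)
    (hsup : ⨆ i, (A i).inf id = ⊤) {i : ι} {x : E} (hx : ∀ V ∈ f, V ∈ A i → x ∈ V) :
    x ∈ (A i).inf id := by
  classical
  obtain ⟨y, hy⟩ := (mem_iSup_iff_exists_dfinsupp' _ x).1 (hsup ▸ mem_top : x ∈ ⨆ i, (A i).inf id)
  rw [DFinsupp.sum_eq_sum_fintype _ (fun _ => rfl)] at hy
  simp only [DFinsupp.equivFunOnFintype_apply] at hy
  have hzero := eq_zero_of_sum_eq_zero_of_copartition hf hA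
    (z := fun j => (y j : E) - if j = i then x else 0) (fun j V hV hVj => ?_)
    (by simp [Finset.sum_sub_distrib, hy]) i
  · rw [if_pos rfl, sub_eq_zero] at hzero
    exact hzero ▸ (y i).2
  · refine sub_mem (mem_finsetInf.1 (y j).2 V hVj) ?_
    split_ifs with h
    · exact hx V hV (h ▸ hVj)
    · exact zero_mem V

end Copartition

end Submodule


open scoped Classical

/-- For a dense free abelian subgroup `Γ ≤ ℝ^n` of rank `k` satisfying the
minimal-complexity rank condition for every flag of `ℋ₀`, and a copartition decomposition
`{A_i}` with `X_i = ⋂_{V ∈ A_i} V` and `Γ_i = Γ ∩ X_i`, the sum `Γ₁ + ⋯ + Γ_m` has finite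
index in `Γ`. -/
theorem stmt_9 (n k m : ℕ) (hn : 1 ≤ n) (hm : 2 ≤ m)
    (Γ : AddSubgroup (Fin n → ℝ)) (hdense : Dense (Γ : Set (Fin n → ℝ)))
    [Module.Free ℤ ↥Γ] [Module.Finite ℤ ↥Γ] (hΓ : Module.finrank ℤ ↥Γ = k)
    (H0 : Finset (Submodule ℝ (Fin n → ℝ)))
    (hhyp : ∀ V ∈ H0, Module.finrank ℝ ↥V = n - 1)
    (hint : H0.inf id = ⊥)
    (hC : ∀ f : Finset (Submodule ℝ (Fin n → ℝ)), f ⊆ H0 → f.card = n → f.inf id = ⊥ →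
      ∑ V ∈ f, Module.finrank ℤ ↥(Γ ⊓ V.toAddSubgroup) = (n - 1) * k)
    (A : Fin m → Finset (Submodule ℝ (Fin n → ℝ)))
    (hsub : ∀ i, A i ⊆ H0)
    (hcop : ∀ V ∈ H0, ∃! i, V ∉ A i)
    (hnontriv : ∀ i, A i ≠ ∅ ∧ A i ≠ H0)
    (hsup : (⨆ i, ((A i).inf id : Submodule ℝ (Fin n → ℝ))) = ⊤) :
    ((⨆ i, Γ ⊓ ((A i).inf id).toAddSubgroup).addSubgroupOf Γ).index ≠ 0 := by
  obtain ⟨f, hfH, hfcard, hfbot⟩ := Submodule.exists_subset_card_eq_finrank_inf_eq_bot H0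
    (fun V hV => by rw [hhyp V hV, Module.finrank_fin_fun]; lia) hint
  rw [Module.finrank_fin_fun] at hfcard
  have hA : ∀ V ∈ f, ∃! i, V ∉ A i := fun V hV => hcop V (hfH hV)
  let P : Submodule ℝ (Fin n → ℝ) → Submodule ℤ Γ := fun V =>
    AddSubgroup.toIntSubmodule (V.toAddSubgroup.addSubgroupOf Γ)
  have hP : ∀ V (x : Γ), x ∈ P V ↔ (x : Fin n → ℝ) ∈ V := fun V x => Iff.rfl
  have hPrank : ∀ V : Submodule ℝ (Fin n → ℝ),
      Module.finrank ℤ ↥(Γ ⊓ V.toAddSubgroup) = Module.finrank ℤ (P V) := by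
    intro V
    have e : ↥(V.toAddSubgroup.addSubgroupOf Γ) ≃+ ↥(Γ ⊓ V.toAddSubgroup) :=
      { toFun := fun x => ⟨x.1.1, x.1.2, x.2⟩
        invFun := fun x => ⟨⟨x.1, x.2.1⟩, x.2.2⟩
        map_add' := fun _ _ => rfl }
    exact e.symm.toIntLinearEquiv.finrank_eq
  let X : Fin m → Submodule ℝ (Fin n → ℝ) := fun i => (A i).inf id
  let c : Submodule ℝ (Fin n → ℝ) → ℕ := fun V => k - Module.finrank ℤ (P V)
  have hc : ∑ V ∈ f, c V = k := by
    have h1 := hC f hfH hfcard hfbot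
    simp only [hPrank] at h1
    have h2 : ∑ V ∈ f, (c V + Module.finrank ℤ (P V)) = n * k := by
      rw [Finset.sum_congr rfl (g := fun _ => k), Finset.sum_const, hfcard, smul_eq_mul]
      intro V _
      exact Nat.sub_add_cancel (hΓ ▸ Submodule.finrank_le (P V))
    rw [Finset.sum_add_distrib, h1] at h2
    obtain ⟨n, rfl⟩ := Nat.exists_eq_add_of_le' hn
    rw [Nat.add_sub_cancel, add_mul, one_mul] at h2
    lia
  have hX : ∀ i, ∑ V ∈ f with V ∉ A i, c V ≤ Module.finrank ℤ (P (X i)) := by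
    intro i
    have h1 := Submodule.finrank_le_finrank_finset_inf_add_sum P (f.filter (· ∈ A i))
    have h2 : (f.filter (· ∈ A i)).inf P ≤ P (X i) := by
      intro x hx
      rw [Submodule.mem_finsetInf] at hx
      exact Submodule.mem_inf_of_copartition hfbot hA hsup
        fun V hV hVi => hx V (Finset.mem_filter.2 ⟨hV, hVi⟩)
    have h3 := Submodule.finrank_mono h2
    have h4 := Finset.sum_filter_add_sum_filter_not f (· ∈ A i) c
    rw [hΓ] at h1
    change k ≤ _ + ∑ V ∈ f with V ∈ A i, c V at h1
    rw [hc] at h4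
    omega
  have hsumX : k ≤ ∑ i, Module.finrank ℤ (P (X i)) := by
    refine le_trans (le_of_eq ?_) (Finset.sum_le_sum fun i _ => hX i)
    simp only [Finset.sum_filter]
    rw [Finset.sum_comm, ← hc]
    refine Finset.sum_congr rfl fun V hV => ?_
    obtain ⟨i, hi, huniq⟩ := hA V hV
    rw [Finset.sum_eq_single i (fun j _ hj => if_neg fun h => hj (huniq j h)) (by simp), if_pos hi]
  let φ : (∀ i, P (X i)) →ₗ[ℤ] Γ := ∑ i, (P (X i)).subtype ∘ₗ LinearMap.proj i
  have hφ : ∀ x, φ x = ∑ i, (x i : Γ) := fun x => by simp [φ, LinearMap.sum_apply]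
  have hinj : Function.Injective φ := by
    rw [injective_iff_map_eq_zero]
    intro x hx
    rw [hφ] at hx
    have := Submodule.eq_zero_of_sum_eq_zero_of_copartition hfbot hA
      (z := fun i => ((x i : Γ) : Fin n → ℝ))
      (fun i V _ hVi => Submodule.mem_finsetInf.1 ((hP _ _).1 (x i).2) V hVi)
      (by simpa using congrArg Γ.subtype hx)
    funext i
    exact Subtype.ext (Subtype.ext (this i))
  have hrank : Module.finrank ℤ (LinearMap.range φ) = Module.finrank ℤ Γ := by
    refine le_antisymm (Submodule.finrank_le _) ?_
    rw [LinearMap.finrank_range_of_inj hinj, Module.finrank_pi_fintype, hΓ]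
    exact hsumX
  have hfin : Finite (Γ ⧸ (LinearMap.range φ).toAddSubgroup) :=
    Submodule.finiteQuotientOfFreeOfRankEq _ hrank
  have hle : (LinearMap.range φ).toAddSubgroup ≤
      (⨆ i, Γ ⊓ ((A i).inf id).toAddSubgroup).addSubgroupOf Γ := by
    rintro _ ⟨x, rfl⟩
    rw [hφ]
    refine sum_mem fun i _ => AddSubgroup.mem_addSubgroupOf.2 ?_
    exact AddSubgroup.mem_iSup_of_mem i ⟨(x i : Γ).2, (x i).2⟩
  have : (LinearMap.range φ).toAddSubgroup.FiniteIndex := ⟨AddSubgroup.index_ne_zero_of_finite⟩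
  exact (AddSubgroup.finiteIndex_of_le hle).index_ne_zero
end

section
/- Let 1 ≤ n < k, let π : ℝ^k → ℝ^n be a linear map that is injective on ℤ^k and such that π(ℤ^k) is dense in ℝ^n, and set δ = (k−n)/n. Then there exists a constant c > 0 such that ‖π(v)‖ ≤ c·‖v‖^{−δ} for infinitely many v ∈ ℤ^k. (A Dirichlet-type theorem showing the Diophantine exponent δ is optimal.) -/
/-- Pigeonhole principle in a cube: more than `m ^ n` points in the open cube `(-B, B)^n`
include two distinct ones at sup-distance at most `2 * B / m`. -/
theorem exists_ne_norm_sub_le_of_pow_lt_card {ι : Type*} [Fintype ι] {n m : ℕ} {B : ℝ}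
    (hm : 0 < m) (hB : 0 < B) (f : ι → Fin n → ℝ) (hf : ∀ i j, |f i j| < B)
    (hcard : m ^ n < Fintype.card ι) :
    ∃ i i', i ≠ i' ∧ ‖f i - f i'‖ ≤ 2 * B / m := by
  have hm' : (0 : ℝ) < m := by exact_mod_cast hm
  have hpos (i j) : 0 ≤ (f i j + B) / (2 * B) * m := by
    have := (abs_lt.1 (hf i j)).1
    have : 0 ≤ f i j + B := by linarith
    positivity
  have hlt (i j) : ⌊(f i j + B) / (2 * B) * m⌋₊ < m := by
    rw [Nat.floor_lt (hpos i j)]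
    have := (abs_lt.1 (hf i j)).2
    have h1 : (f i j + B) / (2 * B) < 1 := by
      rw [div_lt_one (by positivity)]
      linarith
    nlinarith
  obtain ⟨i, i', hne, heq⟩ := Fintype.exists_ne_map_eq_of_card_lt
    (fun i j => (⟨_, hlt i j⟩ : Fin m)) (by simpa using hcard)
  refine ⟨i, i', hne, (pi_norm_le_iff_of_nonneg (by positivity)).2 fun j => ?_⟩
  have hj : ⌊(f i j + B) / (2 * B) * m⌋₊ = ⌊(f i' j + B) / (2 * B) * m⌋₊ :=
    congrArg Fin.val (congrFun heq j)
  have h1 := Nat.floor_le (hpos i j)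
  have h2 := Nat.lt_floor_add_one ((f i j + B) / (2 * B) * m)
  have h3 := Nat.floor_le (hpos i' j)
  have h4 := Nat.lt_floor_add_one ((f i' j + B) / (2 * B) * m)
  rw [hj] at h1 h2
  have hd : (f i j + B) / (2 * B) * m - (f i' j + B) / (2 * B) * m
      = (f i j - f i' j) / (2 * B / m) := by
    field_simp
    ring
  have habs : |(f i j - f i' j) / (2 * B / m)| < 1 := by
    rw [← hd, abs_lt]
    constructor <;> linarith
  have hs : 0 < 2 * B / m := by positivity
  rw [abs_div, abs_of_pos hs, div_lt_one hs] at habs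
  simpa using habs.le

/-- Dirichlet's theorem for a linear map: with `‖π x‖ ≤ C‖x‖` there are nonzero integer vectors
of norm at most `M ^ n` whose image has norm at most `2 * C * M ^ n / M ^ k`. -/
theorem exists_int_vector_norm_map_le {k n M : ℕ} (hM : 0 < M) (hk : k ≠ 0)
    (π : (Fin k → ℝ) →ₗ[ℝ] (Fin n → ℝ)) {C : ℝ} (hC : 0 < C)
    (hπ : ∀ x, x ≠ 0 → ‖π x‖ < C * ‖x‖) :
    ∃ v : Fin k → ℤ, v ≠ 0 ∧ ‖(fun i => (v i : ℝ) : Fin k → ℝ)‖ ≤ (M : ℝ) ^ n ∧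
      ‖π fun i => (v i : ℝ)‖ ≤ 2 * (C * (M : ℝ) ^ n) / (M : ℝ) ^ k := by
  have hM' : (0 : ℝ) < M := by exact_mod_cast hM
  have hB : 0 < C * (M : ℝ) ^ n := by positivity
  let e : (Fin k → Fin (M ^ n + 1)) → Fin k → ℝ := fun a i => ((a i : ℕ) : ℝ)
  have hle (a : Fin k → Fin (M ^ n + 1)) (i) : ((a i : ℕ) : ℝ) ≤ (M : ℝ) ^ n := by
    exact_mod_cast Nat.lt_succ_iff.1 (a i).2
  have he (a) : ‖e a‖ ≤ (M : ℝ) ^ n := by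
    refine (pi_norm_le_iff_of_nonneg (by positivity)).2 fun i => ?_
    simpa [e] using hle a i
  obtain ⟨a, b, hab, h⟩ := exists_ne_norm_sub_le_of_pow_lt_card (m := M ^ k) (by positivity) hB
    (fun a => π (e a)) (fun a j => by
      have hj : |π (e a) j| ≤ ‖π (e a)‖ := norm_le_pi_norm (π (e a)) j
      by_cases h0 : e a = 0
      · simpa [h0] using hB
      · exact hj.trans_lt ((hπ _ h0).trans_le (by gcongr; exact he a)))
    (by
      simp only [Fintype.card_pi, Fintype.card_fin, Finset.prod_const, Finset.card_univ]
      rw [← pow_mul, mul_comm, pow_mul]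
      exact Nat.pow_lt_pow_left (Nat.lt_succ_self _) hk)
  refine ⟨fun i => (a i : ℕ) - (b i : ℕ), fun h0 => hab ?_, ?_, ?_⟩
  · funext i
    have := congrFun h0 i
    simp only [Pi.zero_apply] at this
    ext
    omega
  · refine (pi_norm_le_iff_of_nonneg (by positivity)).2 fun i => ?_
    have h1 := hle a i
    have h2 := hle b i
    have h3 : (0 : ℝ) ≤ ((a i : ℕ) : ℝ) := by positivity
    have h4 : (0 : ℝ) ≤ ((b i : ℕ) : ℝ) := by positivity
    push_cast
    rw [Real.norm_eq_abs, abs_le]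
    constructor <;> linarith
  · have hsub : (fun i => (((a i : ℕ) - (b i : ℕ) : ℤ) : ℝ) : Fin k → ℝ) = e a - e b := by
      funext i
      simp [e]
    rw [hsub, map_sub]
    simpa using h

/-- Dirichlet-type theorem. For a cut and project projection
`π : ℝ^k → ℝ^n` (injective on `ℤ^k`, dense image of `ℤ^k`) there is `c > 0` such that
`‖π(v)‖ ≤ c·‖v‖^{−δ}` for infinitely many `v ∈ ℤ^k`, where `δ = (k−n)/n`. -/
theorem stmt_11 (k n : ℕ) (hn : 1 ≤ n) (hnk : n < k)
    (π : (Fin k → ℝ) →ₗ[ℝ] (Fin n → ℝ))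
    (hinj : ∀ v w : Fin k → ℤ, π (fun i => (v i : ℝ)) = π (fun i => (w i : ℝ)) → v = w)
    (hdense : Dense (Set.range fun v : Fin k → ℤ => π fun i => (v i : ℝ))) :
    ∃ c > 0, {v : Fin k → ℤ |
      ‖π fun i => (v i : ℝ)‖
        ≤ c * ‖(fun i => (v i : ℝ) : Fin k → ℝ)‖ ^ (-(((k : ℝ) - n) / n))}.Infinite := by
  set C : ℝ := ‖LinearMap.toContinuousLinearMap π‖ + 1 with hCdef
  have hC : 0 < C := by positivity
  have hπ (x) (hx : x ≠ 0) : ‖π x‖ < C * ‖x‖ := by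
    have h1 : ‖π x‖ ≤ ‖LinearMap.toContinuousLinearMap π‖ * ‖x‖ :=
      (LinearMap.toContinuousLinearMap π).le_opNorm x
    have h2 := norm_pos_iff.2 hx
    rw [hCdef]
    linarith
  have hn' : (0 : ℝ) < n := by exact_mod_cast hn
  have hnk' : (n : ℝ) < k := by exact_mod_cast hnk
  refine ⟨2 * C, by positivity, fun hfin => ?_⟩
  have hpos (v : Fin k → ℤ) (hv : v ≠ 0) : 0 < ‖π fun i => (v i : ℝ)‖ := by
    refine norm_pos_iff.2 fun h => hv (hinj v 0 ?_)
    have h0 : (fun i => ((0 : Fin k → ℤ) i : ℝ)) = (0 : Fin k → ℝ) := by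
      funext i
      simp
    rw [h, h0, map_zero]
  obtain ⟨ε, hε, hmin⟩ : ∃ ε > 0, ∀ v : Fin k → ℤ, v ≠ 0 →
      ‖π fun i => (v i : ℝ)‖
        ≤ 2 * C * ‖(fun i => (v i : ℝ) : Fin k → ℝ)‖ ^ (-(((k : ℝ) - n) / n)) →
      ε ≤ ‖π fun i => (v i : ℝ)‖ := by
    have hsub := hfin.subset (Set.sep_subset _ (· ≠ 0))
    obtain ⟨ε, hε, h⟩ := (hsub.image fun v : Fin k → ℤ =>
      ‖π fun i => (v i : ℝ)‖).isClosed.isOpen_compl.mem_nhds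
        (x := 0) (by rintro ⟨v, hv, h0⟩; exact (hpos v hv.2).ne' h0) |> Metric.mem_nhds_iff.1
    refine ⟨ε, hε, fun v hv0 hv => not_lt.1 fun hlt => ?_⟩
    exact h (a := ‖π fun i => (v i : ℝ)‖) (by simpa using hlt) ⟨v, ⟨hv, hv0⟩, rfl⟩
  obtain ⟨M, hM⟩ := exists_nat_gt (2 * C / ε)
  have hM' : (0 : ℝ) < M := lt_trans (by positivity) hM
  have hM1 : 0 < M := by exact_mod_cast hM'
  obtain ⟨v, hv, hvn, hvπ⟩ := exists_int_vector_norm_map_le hM1 (by omega) π hC hπ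
  have hv0 : 0 < ‖(fun i => (v i : ℝ) : Fin k → ℝ)‖ := by
    refine norm_pos_iff.2 fun h => hv (funext fun i => ?_)
    simpa using congrFun h i
  have hexp : ((M : ℝ) ^ n) ^ (-(((k : ℝ) - n) / n)) = (M : ℝ) ^ n / (M : ℝ) ^ k := by
    rw [← Real.rpow_natCast, ← Real.rpow_mul hM'.le, ← Real.rpow_natCast, ← Real.rpow_sub hM']
    congr 1
    field_simp
    ring
  have hle := hmin v hv <| calc
    ‖π fun i => (v i : ℝ)‖ ≤ 2 * C * ((M : ℝ) ^ n / (M : ℝ) ^ k) := by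
      rw [← mul_div_assoc, mul_assoc]
      exact hvπ
    _ ≤ _ := by
      rw [← hexp]
      exact mul_le_mul_of_nonneg_left (Real.rpow_le_rpow_of_nonpos hv0 hvn
        (neg_nonpos.2 (div_nonneg (by linarith) hn'.le))) (by positivity)
  have hsmall : 2 * (C * (M : ℝ) ^ n) / (M : ℝ) ^ k ≤ 2 * C / M := by
    rw [div_le_div_iff₀ (by positivity) hM']
    have : (M : ℝ) ^ (n + 1) ≤ (M : ℝ) ^ k :=
      pow_le_pow_right₀ (by exact_mod_cast hM1) hnk
    rw [pow_succ] at this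
    nlinarith
  rw [div_lt_iff₀ hε] at hM
  have := (hle.trans hvπ).trans hsmall
  rw [le_div_iff₀ hM'] at this
  linarith
end

section
/- Let 1 ≤ n < k, let π : ℝ^k → ℝ^n be a linear map that is injective on ℤ^k and such that π(ℤ^k) is dense in ℝ^n, and set δ = (k−n)/n. If π(ℤ^k) is Diophantine, then π(ℤ^k) is densely distributed: there exists C > 0 such that for every r > 0 and every x ∈ ℝ^n with ‖x‖ ≤ 1 there exists v ∈ ℤ^k with ‖v‖ ≤ r and ‖x − π(v)‖ ≤ C·r^{−δ}. -/
section LatticeCovering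

variable {E F : Type*} [NormedAddCommGroup E] [NormedAddCommGroup F]

/-- The anisotropic distance from `y` to the image of `p`: the least scale `T` (as an infimum) at
which some `v` satisfies `‖v‖ ≤ T * R` and `S * ‖y - p v‖ ≤ T`. -/
noncomputable def latticeDepth (p : E →+ F) (R S : ℝ) (y : F) : ℝ :=
  ⨅ v, max (‖v‖ / R) (S * ‖y - p v‖)

theorem latticeDepth_bddBelow (p : E →+ F) {R S : ℝ} (hR : 0 < R) (y : F) :
    BddBelow (Set.range fun v => max (‖v‖ / R) (S * ‖y - p v‖)) :=
  ⟨0, by rintro _ ⟨v, rfl⟩; exact le_max_of_le_left (by positivity)⟩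

theorem latticeDepth_nonneg (p : E →+ F) {R S : ℝ} (hR : 0 < R) (y : F) :
    0 ≤ latticeDepth p R S y :=
  le_ciInf fun _ => le_max_of_le_left (by positivity)

theorem latticeDepth_zero (p : E →+ F) {R S : ℝ} (hR : 0 < R) :
    latticeDepth p R S 0 = 0 :=
  le_antisymm ((ciInf_le (latticeDepth_bddBelow p hR 0) 0).trans (by simp))
    (latticeDepth_nonneg p hR 0)

/-- Translating by a lattice vector `p w` with `‖w‖ ≤ a * R`, up to an error of size `b / S`,
changes the depth by at most `a + b`. -/
theorem latticeDepth_le_add (p : E →+ F) {R S a b : ℝ} (hR : 0 < R) (hS : 0 < S)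
    {y z : F} {w : E} (hw : ‖w‖ ≤ a * R) (hyz : S * ‖y - z - p w‖ ≤ b) :
    latticeDepth p R S y ≤ latticeDepth p R S z + (a + b) := by
  have ha : 0 ≤ a := nonneg_of_mul_nonneg_left ((norm_nonneg w).trans hw) hR
  have hb : 0 ≤ b := le_trans (by positivity) hyz
  rw [← sub_le_iff_le_add]
  refine le_ciInf fun v => ?_
  rw [sub_le_iff_le_add]
  refine (ciInf_le (latticeDepth_bddBelow p hR y) (v + w)).trans (max_le ?_ ?_)
  · have h : ‖v + w‖ / R ≤ ‖v‖ / R + a := by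
      rw [div_add' _ _ _ hR.ne']
      gcongr
      linarith [norm_add_le v w]
    linarith [le_max_left (‖v‖ / R) (S * ‖z - p v‖)]
  · have h : ‖y - p (v + w)‖ ≤ ‖z - p v‖ + ‖y - z - p w‖ := by
      refine le_trans (le_of_eq ?_) (norm_add_le _ _)
      rw [map_add]
      congr 1
      abel
    have := mul_le_mul_of_nonneg_left h hS.le
    linarith [le_max_right (‖v‖ / R) (S * ‖z - p v‖)]

theorem continuous_latticeDepth (p : E →+ F) {R S : ℝ} (hR : 0 < R) (hS : 0 < S) :
    Continuous (latticeDepth p R S) := by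
  refine (LipschitzWith.of_le_add_mul ⟨S, hS.le⟩ fun y z => ?_).continuous
  have := latticeDepth_le_add p (a := 0) (b := S * dist y z) (w := 0) (y := y) (z := z) hR hS
    (by simp) (by simp [dist_eq_norm])
  rwa [zero_add] at this

/-- Points of prescribed smaller depth exist inside the unit ball. -/
theorem exists_latticeDepth_eq [NormedSpace ℝ F] (p : E →+ F) {R S : ℝ} (hR : 0 < R) (hS : 0 < S)
    {x : F} (hx : ‖x‖ ≤ 1) {d : ℝ} (hd : 0 ≤ d) (hdx : d ≤ latticeDepth p R S x) :
    ∃ y : F, ‖y‖ ≤ 1 ∧ latticeDepth p R S y = d := by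
  have hc : ContinuousOn (fun t : ℝ => latticeDepth p R S (t • x)) (Set.Icc 0 1) :=
    ((continuous_latticeDepth p hR hS).comp (by fun_prop)).continuousOn
  obtain ⟨t, ht, h⟩ := intermediate_value_Icc zero_le_one hc
    (show d ∈ Set.Icc _ _ by simpa [latticeDepth_zero p hR] using ⟨hd, hdx⟩)
  refine ⟨t • x, ?_, h⟩
  rw [norm_smul, Real.norm_of_nonneg ht.1]
  exact mul_le_one₀ ht.2 (norm_nonneg x) hx

/-- Pigeonhole principle: too many translates `y j + p v` with `‖v‖ ≤ R` force two of them to be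
within `ε / S`. -/
theorem exists_close_translates {k n N : ℕ} (p : (Fin k → ℤ) →+ (Fin n → ℝ)) {R S M ε : ℝ}
    (hR : 1 ≤ R) (hS : 1 ≤ S) (hRS : (R * S) ^ n = R ^ k) (hM : 0 ≤ M)
    (hpM : ∀ v, ‖p v‖ ≤ M * ‖v‖) (hε : 0 < ε) (hε1 : ε ≤ 1)
    (hN : (4 * (1 + M) / ε) ^ n < N) (y : ℕ → Fin n → ℝ) (hy : ∀ j < N, ‖y j‖ ≤ 1) :
    ∃ i < N, ∃ j < N, ∃ v w : Fin k → ℤ, (i ≠ j ∨ v ≠ w) ∧ ‖v - w‖ ≤ 2 * R ∧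
      S * ‖y i + p v - (y j + p w)‖ ≤ ε := by
  have hR0 : 0 < R := by linarith
  have hS0 : 0 < S := by linarith
  set m : ℤ := ⌊R⌋
  set Q : ℝ := (1 + M) * (R * S) / ε with hQ
  have hQ1 : 1 ≤ Q := by
    rw [hQ, le_div_iff₀ hε, one_mul]
    nlinarith [one_le_mul_of_one_le_of_one_le hR hS]
  have hm0 : 0 ≤ m := Int.floor_nonneg.2 hR0.le
  have hQ0 : 0 ≤ ⌊Q⌋ := Int.floor_nonneg.2 (by linarith)
  set s : Finset (ℕ × (Fin k → ℤ)) :=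
    Finset.range N ×ˢ Fintype.piFinset fun _ => Finset.Icc (-m) m with hs
  set t : Finset (Fin n → ℤ) :=
    Fintype.piFinset fun _ => Finset.Icc (-⌊Q⌋ - 1) ⌊Q⌋ with ht
  set f : ℕ × (Fin k → ℤ) → Fin n → ℤ :=
    fun q l => ⌊(y q.1 + p q.2) l * (S / ε)⌋ with hf
  have hnorm : ∀ q ∈ s, ‖q.2‖ ≤ R := by
    intro q hq
    rw [hs, Finset.mem_product, Fintype.mem_piFinset] at hq
    refine (pi_norm_le_iff_of_nonneg hR0.le).2 fun i => ?_
    have h := Finset.mem_Icc.1 (hq.2 i)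
    have h' : |q.2 i| ≤ m := abs_le.2 h
    rw [Int.norm_eq_abs]
    calc |((q.2 i : ℤ) : ℝ)| = ((|q.2 i| : ℤ) : ℝ) := by push_cast; rfl
      _ ≤ m := by exact_mod_cast h'
      _ ≤ R := Int.floor_le R
  have hmaps : ∀ q ∈ s, f q ∈ t := by
    intro q hq
    have hq1 : q.1 < N := Finset.mem_range.1 (Finset.mem_product.1 hq).1
    refine Fintype.mem_piFinset.2 fun l => ?_
    have h1 : ‖y q.1 + p q.2‖ ≤ (1 + M) * R := by
      have := mul_le_mul_of_nonneg_left (hnorm q hq) hM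
      linarith [norm_add_le (y q.1) (p q.2), hy _ hq1, hpM q.2]
    have h2 : |(y q.1 + p q.2) l * (S / ε)| ≤ Q := by
      rw [abs_mul, abs_of_pos (div_pos hS0 hε)]
      calc _ ≤ ((1 + M) * R) * (S / ε) := by
            gcongr
            exact (norm_le_pi_norm (y q.1 + p q.2) l).trans h1
        _ = Q := by rw [hQ]; ring
    obtain ⟨h3, h4⟩ := abs_le.1 h2
    refine Finset.mem_Icc.2 ⟨Int.le_floor.2 ?_, Int.floor_le_floor h4⟩
    push_cast
    linarith [Int.lt_floor_add_one Q]
  have hcard : t.card < s.card := by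
    have hsc : (N : ℝ) * R ^ k ≤ s.card := by
      have hbox : R ≤ ((m + 1 - -m).toNat : ℝ) := by
        have h0 : ((m + 1 - -m).toNat : ℤ) = m + 1 - -m := Int.toNat_of_nonneg (by omega)
        have h1 : ((m + 1 - -m).toNat : ℝ) = m + 1 - -m := by exact_mod_cast h0
        have h2 : (0 : ℝ) ≤ m := by exact_mod_cast hm0
        rw [h1]
        linarith [Int.lt_floor_add_one R]
      simp only [hs, Finset.card_product, Finset.card_range, Fintype.card_piFinset, Int.card_Icc,
        Finset.prod_const, Finset.card_univ, Fintype.card_fin]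
      push_cast
      gcongr
    have htc : (t.card : ℝ) ≤ (4 * Q) ^ n := by
      have hbox : ((⌊Q⌋ + 1 - (-⌊Q⌋ - 1)).toNat : ℝ) ≤ 4 * Q := by
        have h0 : ((⌊Q⌋ + 1 - (-⌊Q⌋ - 1)).toNat : ℤ) = ⌊Q⌋ + 1 - (-⌊Q⌋ - 1) :=
          Int.toNat_of_nonneg (by omega)
        have h1 : ((⌊Q⌋ + 1 - (-⌊Q⌋ - 1)).toNat : ℝ) = ⌊Q⌋ + 1 - (-⌊Q⌋ - 1) := by
          exact_mod_cast h0
        rw [h1]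
        linarith [Int.floor_le Q]
      simp only [ht, Fintype.card_piFinset, Int.card_Icc, Finset.prod_const, Finset.card_univ,
        Fintype.card_fin]
      push_cast
      gcongr
    have hQn : (4 * Q) ^ n = (4 * (1 + M) / ε) ^ n * R ^ k := by
      rw [← hRS, ← mul_pow, hQ]
      congr 1
      ring
    have : (t.card : ℝ) < s.card := by
      refine htc.trans_lt (lt_of_lt_of_le ?_ hsc)
      rw [hQn]
      gcongr
    exact_mod_cast this
  obtain ⟨a, ha, b, hb, hab, hfab⟩ :=
    Finset.exists_ne_map_eq_of_card_lt_of_maps_to hcard hmaps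
  refine ⟨a.1, Finset.mem_range.1 (Finset.mem_product.1 ha).1,
    b.1, Finset.mem_range.1 (Finset.mem_product.1 hb).1, a.2, b.2, ?_, ?_, ?_⟩
  · by_contra! h
    exact hab (Prod.ext h.1 h.2)
  · linarith [norm_sub_le a.2 b.2, hnorm a ha, hnorm b hb]
  · rw [← le_div_iff₀' hS0]
    refine (pi_norm_le_iff_of_nonneg (by positivity)).2 fun l => ?_
    have h := (Int.abs_sub_lt_one_of_floor_eq_floor (congrFun hfab l)).le
    rw [← sub_mul, abs_mul, abs_of_pos (div_pos hS0 hε), ← le_div_iff₀ (div_pos hS0 hε),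
      one_div_div] at h
    exact h

/-- If no nonzero vector of the lattice is short at scale `(R, S)`, the depth is bounded on the unit
ball independently of the scale. -/
theorem latticeDepth_lt {k n N : ℕ} (p : (Fin k → ℤ) →+ (Fin n → ℝ)) {R S M ε : ℝ}
    (hR : 1 ≤ R) (hS : 1 ≤ S) (hRS : (R * S) ^ n = R ^ k) (hM : 0 ≤ M)
    (hpM : ∀ v, ‖p v‖ ≤ M * ‖v‖) (hε : 0 < ε) (hε1 : ε ≤ 1)
    (hN : (4 * (1 + M) / ε) ^ n < N)
    (hp : ∀ v, v ≠ 0 → ‖v‖ ≤ 2 * R → ε < S * ‖p v‖) {x : Fin n → ℝ} (hx : ‖x‖ ≤ 1) :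
    latticeDepth p R S x < 4 * N := by
  have hR0 : 0 < R := by linarith
  have hS0 : 0 < S := by linarith
  by_contra! hge
  have key : ∀ j : ℕ, ∃ y : Fin n → ℝ, j < N → ‖y‖ ≤ 1 ∧ latticeDepth p R S y = 4 * j := by
    intro j
    by_cases hj : j < N
    · have hj' : (j : ℝ) ≤ N := by exact_mod_cast hj.le
      obtain ⟨y, hy⟩ := exists_latticeDepth_eq p hR0 hS0 hx (d := 4 * j) (by positivity)
        (by linarith)
      exact ⟨y, fun _ => hy⟩
    · exact ⟨0, fun h => absurd h hj⟩
  choose y hy using key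
  obtain ⟨i, hi, j, hj, v, w, hne, hvw, hclose⟩ := exists_close_translates p hR hS hRS hM hpM hε
    hε1 hN y fun j hj => (hy j hj).1
  have hdist : ∀ {i j : ℕ} {v w : Fin k → ℤ}, i < N → j < N → ‖v - w‖ ≤ 2 * R →
      S * ‖y i + p v - (y j + p w)‖ ≤ ε → i ≤ j := by
    intro i j v w hi hj hvw hclose
    have h := latticeDepth_le_add p (y := y i) (z := y j) (w := w - v) hR0 hS0
      (by rwa [norm_sub_rev]) (b := ε) (by
        rwa [map_sub, show y i - y j - (p w - p v) = y i + p v - (y j + p w) by abel])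
    rw [(hy i hi).2, (hy j hj).2] at h
    have : (i : ℝ) < j + 1 := by linarith
    exact Nat.lt_succ_iff.1 (by exact_mod_cast this)
  have hij : i = j := le_antisymm (hdist hi hj hvw hclose)
    (hdist hj hi (by rwa [norm_sub_rev]) (by rwa [norm_sub_rev]))
  subst hij
  have hvw0 : v - w ≠ 0 := sub_ne_zero.2 (hne.resolve_left fun h => h rfl)
  have h := hp (v - w) hvw0 hvw
  rw [add_sub_add_left_eq_sub, ← map_sub] at hclose
  linarith

end LatticeCovering

/-- If the projected lattice `π(ℤ^k)` is Diophantine (with exponent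
`δ = (k−n)/n`) then it is densely distributed: there is `C > 0` such that for every
`r > 0`, every point of the unit ball of `ℝ^n` is within `C·r^{−δ}` of `π(v)` for some
`v ∈ ℤ^k` with `‖v‖ ≤ r`. -/
theorem stmt_15 (k n : ℕ) (hn : 1 ≤ n) (hnk : n < k)
    (π : (Fin k → ℝ) →ₗ[ℝ] (Fin n → ℝ))
    (hinj : ∀ v w : Fin k → ℤ, π (fun i => (v i : ℝ)) = π (fun i => (w i : ℝ)) → v = w)
    (hdense : Dense (Set.range fun v : Fin k → ℤ => π fun i => (v i : ℝ)))
    (hdioph : ∃ c > 0, ∀ v : Fin k → ℤ, v ≠ 0 →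
      c * ‖(fun i => (v i : ℝ) : Fin k → ℝ)‖ ^ (-(((k : ℝ) - n) / n))
        ≤ ‖π fun i => (v i : ℝ)‖) :
    ∃ C > 0, ∀ r > 0, ∀ x : Fin n → ℝ, ‖x‖ ≤ 1 →
      ∃ v : Fin k → ℤ, ‖(fun i => (v i : ℝ) : Fin k → ℝ)‖ ≤ r ∧
        ‖x - π fun i => (v i : ℝ)‖ ≤ C * r ^ (-(((k : ℝ) - n) / n)) := by
  obtain ⟨c, hc, hdioph⟩ := hdioph
  set δ : ℝ := ((k : ℝ) - n) / n with hδ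
  have hn0 : (0 : ℝ) < n := by exact_mod_cast hn
  have hδ0 : 0 < δ := div_pos (sub_pos.2 (by exact_mod_cast hnk)) hn0
  have hnorm : ∀ v : Fin k → ℤ, ‖(fun i => (v i : ℝ) : Fin k → ℝ)‖ = ‖v‖ := fun _ => rfl
  let p : (Fin k → ℤ) →+ (Fin n → ℝ) :=
    π.toAddMonoidHom.comp ((Int.castAddHom ℝ).compLeft (Fin k))
  have hpv : ∀ v : Fin k → ℤ, (π fun i => (v i : ℝ)) = p v := fun v => rfl
  simp only [hnorm, hpv] at hdioph ⊢
  set M : ℝ := ‖π.toContinuousLinearMap‖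
  have hpM : ∀ v, ‖p v‖ ≤ M * ‖v‖ := fun v => by
    rw [← hnorm]
    exact π.toContinuousLinearMap.le_opNorm _
  set ε : ℝ := min 1 (c * 2 ^ (-δ) / 2)
  have hε0 : 0 < ε := by positivity
  obtain ⟨N, hN⟩ := exists_nat_gt ((4 * (1 + M) / ε) ^ n)
  have hN1 : (1 : ℝ) ≤ N := by
    have : (0 : ℝ) < N := lt_of_le_of_lt (by positivity) hN
    exact_mod_cast this
  have hT0 : (0 : ℝ) < 4 * N := by linarith
  have cover : ∀ R : ℝ, 1 ≤ R → ∀ x : Fin n → ℝ, ‖x‖ ≤ 1 → ∃ v : Fin k → ℤ,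
      ‖v‖ ≤ 4 * N * R ∧ ‖x - p v‖ ≤ 4 * N * R ^ (-δ) := by
    intro R hR x hx
    have hR0 : 0 < R := by linarith
    have hRS : (R * R ^ δ) ^ n = R ^ k := by
      rw [← Real.rpow_one_add' hR0.le (by positivity), ← Real.rpow_natCast, ← Real.rpow_mul hR0.le,
        ← Real.rpow_natCast]
      congr 1
      rw [hδ]
      field_simp
      ring
    have h := latticeDepth_lt p hR (Real.one_le_rpow hR hδ0.le) hRS (norm_nonneg _) hpM hε0
      (min_le_left _ _) hN (fun v hv0 hv => by
        have hvpos : 0 < ‖v‖ := norm_pos_iff.2 hv0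
        calc ε ≤ c * 2 ^ (-δ) / 2 := min_le_right _ _
          _ < c * 2 ^ (-δ) := half_lt_self (by positivity)
          _ = R ^ δ * (c * (2 * R) ^ (-δ)) := by
            rw [Real.mul_rpow two_pos.le hR0.le, Real.rpow_neg hR0.le]
            field_simp
          _ ≤ R ^ δ * (c * ‖v‖ ^ (-δ)) := by
            have := Real.rpow_le_rpow_of_nonpos hvpos hv (neg_nonpos.2 hδ0.le)
            gcongr
          _ ≤ R ^ δ * ‖p v‖ := by
            gcongr
            exact hdioph v hv0) hx
    obtain ⟨v, hv⟩ := exists_lt_of_ciInf_lt h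
    obtain ⟨h1, h2⟩ := max_lt_iff.1 hv
    refine ⟨v, ((div_lt_iff₀ hR0).1 h1).le, ?_⟩
    rw [Real.rpow_neg hR0.le, ← div_eq_mul_inv, le_div_iff₀' (by positivity)]
    exact h2.le
  refine ⟨4 * N * (4 * N) ^ δ, by positivity, fun r hr x hx => ?_⟩
  have hscale : 4 * N * (4 * N : ℝ) ^ δ * r ^ (-δ) = 4 * N * (r / (4 * N)) ^ (-δ) := by
    rw [Real.div_rpow hr.le hT0.le, Real.rpow_neg hT0.le]
    field_simp
  rw [hscale]
  rcases le_total (4 * (N : ℝ)) r with hTr | hrT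
  · obtain ⟨v, hv, hxv⟩ := cover (r / (4 * N)) ((one_le_div hT0).2 hTr) x hx
    exact ⟨v, by rwa [mul_div_cancel₀ _ hT0.ne'] at hv, hxv⟩
  · refine ⟨0, by simpa using hr.le, ?_⟩
    have h1 : 1 ≤ (r / (4 * N)) ^ (-δ) :=
      Real.one_le_rpow_of_pos_of_le_one_of_nonpos (by positivity) ((div_le_one hT0).2 hrT)
        (neg_nonpos.2 hδ0.le)
    rw [map_zero, sub_zero]
    nlinarith
end

section
/- Let n ≥ 1 and let 𝒱 be a finite set of linear hyperplanes of ℝ^n. Then there exists a constant C > 0, depending only on 𝒱, with the following property: for every ε > 0 and every compact polytope P ⊂ ℝ^n with nonempty interior which is a finite intersection of closed half-spaces whose boundary hyperplanes are translates of members of 𝒱, if every two distinct vertices (extreme points) of P are at Euclidean distance at least ε from each other, then P contains a closed ball of radius C·ε. -/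
/-- The face of the polyhedron cut out by the inequalities `p.1 x ≤ p.2`, `p ∈ S`, on which the
inequalities indexed by `T` are equalities. -/
def polyhedronFace {E : Type*} [AddCommGroup E] [Module ℝ E] (S T : Finset ((E →ₗ[ℝ] ℝ) × ℝ)) :
    Set E :=
  {x | (∀ p ∈ S, p.1 x ≤ p.2) ∧ ∀ p ∈ T, p.1 x = p.2}

section Module

variable {E : Type*} [AddCommGroup E] [Module ℝ E]

theorem convex_polyhedronFace (S T : Finset ((E →ₗ[ℝ] ℝ) × ℝ)) :
    Convex ℝ (polyhedronFace S T) := by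
  intro x hx y hy a b ha hb hab
  refine ⟨fun p hp => ?_, fun p hp => ?_⟩
  · simp only [map_add, map_smul, smul_eq_mul]
    have h1 := mul_le_mul_of_nonneg_left (hx.1 p hp) ha
    have h2 := mul_le_mul_of_nonneg_left (hy.1 p hp) hb
    have h3 : a * p.2 + b * p.2 = p.2 := by rw [← add_mul, hab, one_mul]
    linarith
  · simp only [map_add, map_smul, smul_eq_mul, hx.2 p hp, hy.2 p hp]
    rw [← add_mul, hab, one_mul]

theorem isExtreme_polyhedronFace {S T : Finset ((E →ₗ[ℝ] ℝ) × ℝ)} (hTS : T ⊆ S) :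
    IsExtreme ℝ (polyhedronFace S ∅) (polyhedronFace S T) := by
  refine ⟨fun x hx => ⟨hx.1, by simp⟩, fun x hx y hy z hz hzxy => ⟨hx.1, fun p hp => ?_⟩⟩
  obtain ⟨a, b, ha, hb, hab, rfl⟩ := hzxy
  have h := hz.2 p hp
  simp only [map_add, map_smul, smul_eq_mul] at h
  have h2 := mul_le_mul_of_nonneg_left (hy.1 p (hTS hp)) hb.le
  have h3 : a * p.2 + b * p.2 = p.2 := by rw [← add_mul, hab, one_mul]
  refine le_antisymm (hx.1 p (hTS hp)) (le_of_mul_le_mul_left ?_ ha)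
  linarith

end Module

section NormedSpace

variable {E : Type*} [NormedAddCommGroup E] [NormedSpace ℝ E]

/-- A ray starting in a bounded face and pointing along it leaves it through a smaller face. -/
theorem exists_add_smul_mem_polyhedronFace_insert [DecidableEq ((E →ₗ[ℝ] ℝ) × ℝ)]
    {S T : Finset ((E →ₗ[ℝ] ℝ) × ℝ)}
    (hb : Bornology.IsBounded (polyhedronFace S T)) {z d : E} (hz : z ∈ polyhedronFace S T)
    (hd : d ≠ 0) (hdT : ∀ p ∈ T, p.1 d = 0) :
    ∃ p ∈ S \ T, ∃ t : ℝ, z + t • d ∈ polyhedronFace S (insert p T) := by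
  have hne : (S.filter fun p => 0 < p.1 d).Nonempty := by
    by_contra hemp
    rw [Finset.not_nonempty_iff_eq_empty, Finset.filter_eq_empty_iff] at hemp
    obtain ⟨R, hR⟩ := hb.exists_norm_le
    have hray : ∀ t : ℝ, 0 ≤ t → z + t • d ∈ polyhedronFace S T := by
      refine fun t ht => ⟨fun p hp => ?_, fun p hp => ?_⟩
      · have := mul_nonpos_of_nonneg_of_nonpos ht (not_lt.1 (hemp hp))
        simp only [map_add, map_smul, smul_eq_mul]
        linarith [hz.1 p hp]
      · simp [hdT p hp, hz.2 p hp]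
    have hdpos : 0 < ‖d‖ := norm_pos_iff.2 hd
    have hR0 : 0 ≤ R := (norm_nonneg z).trans (hR z hz)
    have ht : 0 ≤ (2 * R + 1) / ‖d‖ := by positivity
    have h1 := hR _ (hray _ ht)
    have h2 : ‖((2 * R + 1) / ‖d‖) • d‖ = 2 * R + 1 := by
      rw [norm_smul, Real.norm_of_nonneg ht, div_mul_cancel₀ _ hdpos.ne']
    have h3 := norm_sub_le (z + ((2 * R + 1) / ‖d‖) • d) z
    rw [add_sub_cancel_left, h2] at h3
    linarith [hR z hz]
  obtain ⟨p, hp, hmin⟩ := Finset.exists_min_image _ (fun p => (p.2 - p.1 z) / p.1 d) hne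
  rw [Finset.mem_filter] at hp
  refine ⟨p, Finset.mem_sdiff.2 ⟨hp.1, fun hpT => hp.2.ne' (hdT p hpT)⟩,
    (p.2 - p.1 z) / p.1 d, fun q hq => ?_, fun q hq => ?_⟩
  · simp only [map_add, map_smul, smul_eq_mul]
    rcases le_or_gt (q.1 d) 0 with h | h
    · have := mul_nonpos_of_nonneg_of_nonpos
        (div_nonneg (sub_nonneg.2 (hz.1 p hp.1)) hp.2.le) h
      linarith [hz.1 q hq]
    · have := (le_div_iff₀ h).1 (hmin q (Finset.mem_filter.2 ⟨hq, h⟩))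
      linarith
  · simp only [map_add, map_smul, smul_eq_mul]
    rcases Finset.mem_insert.1 hq with rfl | hq
    · rw [div_mul_cancel₀ _ hp.2.ne']
      ring
    · simp [hdT q hq, hz.2 q hq]

variable [FiniteDimensional ℝ E]

theorem isClosed_polyhedronFace (S T : Finset ((E →ₗ[ℝ] ℝ) × ℝ)) :
    IsClosed (polyhedronFace S T) := by
  have hc (f : E →ₗ[ℝ] ℝ) : Continuous f := f.continuous_of_finiteDimensional
  simp only [polyhedronFace, Set.ofPred_and, Set.ofPred_forall]
  exact (isClosed_biInter fun p _ => isClosed_le (hc p.1) continuous_const).inter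
    (isClosed_biInter fun p _ => isClosed_eq (hc p.1) continuous_const)

/-- A linear functional which separates two points of a compact convex set separates two of its
extreme points. -/
theorem IsCompact.exists_extremePoints_apply_ne {F : Set E} (hF : IsCompact F)
    (hconv : Convex ℝ F) (u : E →ₗ[ℝ] ℝ) {x y : E} (hx : x ∈ F) (hy : y ∈ F) (hxy : u x ≠ u y) :
    ∃ v ∈ F.extremePoints ℝ, ∃ w ∈ F.extremePoints ℝ, u v ≠ u w := by
  by_contra! h
  obtain ⟨v, hv⟩ := hF.extremePoints_nonempty ⟨x, hx⟩
  have hsub : F ⊆ {z | u z = u v} := by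
    rw [← closure_convexHull_extremePoints hF hconv]
    refine closure_minimal (convexHull_min (fun w hw => h w hw v hv) ?_) ?_
    · exact convex_hyperplane u.isLinear _
    · exact isClosed_eq u.continuous_of_finiteDimensional continuous_const
  exact hxy ((hsub hx).trans (hsub hy).symm)

/-- If a linear functional `u` is not constant on a compact polyhedron, then it takes different
values at two vertices which lie on a common face of direction transverse to `ker u`. -/
theorem exists_extremePoints_polyhedron_apply_ne {S : Finset ((E →ₗ[ℝ] ℝ) × ℝ)}
    (hP : IsCompact (polyhedronFace S ∅)) (u : E →ₗ[ℝ] ℝ) {x y : E}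
    (hx : x ∈ polyhedronFace S ∅) (hy : y ∈ polyhedronFace S ∅) (hxy : u x ≠ u y) :
    ∃ T ⊆ S, (∀ d, (∀ p ∈ T, p.1 d = 0) → u d = 0 → d = 0) ∧
      ∃ v ∈ (polyhedronFace S ∅).extremePoints ℝ, ∃ w ∈ (polyhedronFace S ∅).extremePoints ℝ,
        u v ≠ u w ∧ ∀ p ∈ T, p.1 (v - w) = 0 := by
  classical
  obtain ⟨T, hT, hmax⟩ := Finset.exists_max_image
    (S.powerset.filter fun T => ¬ (u '' polyhedronFace S T).Subsingleton) Finset.card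
    ⟨∅, Finset.mem_filter.2 ⟨by simp, fun h =>
      hxy (h (Set.mem_image_of_mem u hx) (Set.mem_image_of_mem u hy))⟩⟩
  rw [Finset.mem_filter, Finset.mem_powerset] at hT
  have hext := isExtreme_polyhedronFace hT.1
  have hF : IsCompact (polyhedronFace S T) :=
    hP.of_isClosed_subset (isClosed_polyhedronFace S T) hext.subset
  have hconv := convex_polyhedronFace S T
  refine ⟨T, hT.1, fun d hd hud => ?_, ?_⟩
  · by_contra hd0
    have hfin : (u '' polyhedronFace S T).Finite := by
      refine Set.Finite.subset (s := ⋃ p ∈ S \ T, u '' polyhedronFace S (insert p T)) ?_ ?_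
      · refine Set.Finite.biUnion (S \ T).finite_toSet fun p hp => ?_
        rw [SetLike.mem_coe, Finset.mem_sdiff] at hp
        refine Set.Subsingleton.finite (not_not.1 fun hns => ?_)
        have := hmax (insert p T) (Finset.mem_filter.2
          ⟨Finset.mem_powerset.2 (Finset.insert_subset hp.1 hT.1), hns⟩)
        rw [Finset.card_insert_of_notMem hp.2] at this
        omega
      · rintro _ ⟨z, hz, rfl⟩
        obtain ⟨p, hp, t, ht⟩ :=
          exists_add_smul_mem_polyhedronFace_insert hF.isBounded hz hd0 hd
        exact Set.mem_biUnion hp ⟨_, ht, by simp [hud]⟩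
    obtain ⟨a, ha, b, hb, hab⟩ := Set.not_subsingleton_iff.1 hT.2 |>.exists_lt
    exact Set.Icc_infinite hab
      (hfin.subset ((hconv.is_linear_image u.isLinear).ordConnected.out ha hb))
  · obtain ⟨_, ⟨a, ha, rfl⟩, _, ⟨b, hb, rfl⟩, hab⟩ := Set.not_subsingleton_iff.1 hT.2
    obtain ⟨v, hv, w, hw, hvw⟩ := hF.exists_extremePoints_apply_ne hconv u ha hb hab
    refine ⟨v, hext.extremePoints_subset_extremePoints hv, w,
      hext.extremePoints_subset_extremePoints hw, hvw, fun p hp => ?_⟩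
    rw [map_sub, hv.1.2 p hp, hw.1.2 p hp, sub_self]

/-- If `ker u` meets `L` trivially, then `u` is uniformly large on `L`. -/
theorem exists_pos_abs_apply_le_of_disjoint_ker (u : E →ₗ[ℝ] ℝ) (L : Submodule ℝ E) :
    ∃ δ > 0, (∀ d ∈ L, u d = 0 → d = 0) →
      ∀ d ∈ L, ∀ y, ‖y‖ ≤ δ * ‖d‖ → |u y| ≤ |u d| := by
  by_cases h : ∀ d ∈ L, u d = 0 → d = 0
  · have hker : (u.domRestrict L).ker = ⊥ := by
      rw [LinearMap.ker_eq_bot']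
      exact fun d hd => Subtype.ext (h d d.2 hd)
    obtain ⟨K, hK, hKL⟩ := (u.domRestrict L).exists_antilipschitzWith hker
    set f := LinearMap.toContinuousLinearMap u
    have hpos : 0 < (K : ℝ) * (‖f‖ + 1) := by positivity
    refine ⟨((K : ℝ) * (‖f‖ + 1))⁻¹, by positivity, fun _ d hd y hy => ?_⟩
    have h1 : ‖d‖ ≤ K * |u d| := by
      simpa using hKL.le_mul_norm (map_zero _) ⟨d, hd⟩
    have h2 : |u y| ≤ ‖f‖ * ‖y‖ := f.le_opNorm y
    have h3 : K * (‖f‖ + 1) * ‖y‖ ≤ ‖d‖ := by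
      rwa [← div_eq_inv_mul, le_div_iff₀' hpos] at hy
    have h4 : (‖f‖ + 1) * ‖y‖ ≤ |u d| := by
      refine le_of_mul_le_mul_left ?_ (NNReal.coe_pos.2 hK)
      linarith
    nlinarith [norm_nonneg y]
  · exact ⟨1, one_pos, fun h' => absurd h' h⟩

/-- A compact polyhedron with nonempty interior, with facets parallel to members of `𝒱` and with
`ε`-separated vertices, has width at least a multiple of `ε` transversally to a proper subspace. -/
theorem exists_pos_forall_polyhedron_width (𝒱 : Finset (Submodule ℝ E)) {V : Submodule ℝ E}
    (hV : V ≠ ⊤) :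
    ∃ δ > 0, ∀ ε > 0, ∀ S : Finset ((E →ₗ[ℝ] ℝ) × ℝ),
      IsCompact (polyhedronFace S ∅) → (interior (polyhedronFace S ∅)).Nonempty →
      (∀ p ∈ S, LinearMap.ker p.1 ∈ 𝒱) →
      (∀ v ∈ (polyhedronFace S ∅).extremePoints ℝ, ∀ w ∈ (polyhedronFace S ∅).extremePoints ℝ,
        v ≠ w → ε ≤ dist v w) →
      ∃ v ∈ polyhedronFace S ∅, ∃ w ∈ polyhedronFace S ∅,
        ∀ f : E →ₗ[ℝ] ℝ, LinearMap.ker f = V → ∀ y, ‖y‖ ≤ δ * ε → |f y| ≤ |f (v - w)| := by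
  classical
  obtain ⟨u, hu, hVu⟩ := V.exists_le_ker_of_lt_top hV.lt_top
  choose δ hδ hδu using fun L : Submodule ℝ E => exists_pos_abs_apply_le_of_disjoint_ker u L
  obtain ⟨𝒯, -, hmin⟩ := Finset.exists_min_image 𝒱.powerset (fun 𝒯 => δ (𝒯.inf id))
    ⟨∅, by simp⟩
  refine ⟨δ (𝒯.inf id), hδ _, fun ε hε S hP hint hS hsep => ?_⟩
  obtain ⟨x, hx, y, hy, hxy⟩ :
      ∃ x ∈ polyhedronFace S ∅, ∃ y ∈ polyhedronFace S ∅, u x ≠ u y := by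
    by_contra! h
    obtain ⟨x, hx⟩ := hint
    refine hu (LinearMap.ext fun d => ?_)
    have hcont : Filter.Tendsto (fun t : ℝ => x + t • d) (nhds 0) (nhds x) :=
      Continuous.tendsto' (by fun_prop) _ _ (by simp)
    have hev := hcont.eventually (isOpen_interior.mem_nhds hx)
    obtain ⟨t, ht, ht0⟩ := ((hev.filter_mono nhdsWithin_le_nhds).and
      (self_mem_nhdsWithin : {(0 : ℝ)}ᶜ ∈ nhdsWithin 0 {0}ᶜ)).exists
    have := h _ (interior_subset ht) _ (interior_subset hx)
    rw [map_add, map_smul, add_eq_left, smul_eq_zero] at this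
    exact this.resolve_left ht0
  obtain ⟨T, hTS, hT, v, hv, w, hw, hvw, hvwT⟩ :=
    exists_extremePoints_polyhedron_apply_ne hP u hx hy hxy
  set L := (T.image fun p => LinearMap.ker p.1).inf id with hLdef
  have hL : ∀ d, d ∈ L ↔ ∀ p ∈ T, p.1 d = 0 := by
    intro d
    simp [hLdef, Submodule.mem_finsetInf]
  have hδL : δ (𝒯.inf id) ≤ δ L := hmin _ (Finset.mem_powerset.2 fun W hW => by
    obtain ⟨p, hp, rfl⟩ := Finset.mem_image.1 hW
    exact hS p (hTS hp))
  refine ⟨v, hv.1, w, hw.1, fun f hf y hy => ?_⟩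
  have hdist := hsep v hv w hw fun h => hvw (h ▸ rfl)
  rw [dist_eq_norm] at hdist
  have huy : |u y| ≤ |u (v - w)| :=
    hδu L (fun d hd => hT d ((hL d).1 hd)) _ ((hL _).2 hvwT) y
      (hy.trans (mul_le_mul hδL hdist hε.le (hδ _).le))
  have hspan : u ∈ Submodule.span ℝ (Set.range fun _ : Unit => f) :=
    mem_span_of_iInf_ker_le_ker (by simpa [hf] using hVu)
  rw [Set.range_const, Submodule.mem_span_singleton] at hspan
  obtain ⟨c, rfl⟩ := hspan
  simp only [LinearMap.smul_apply, smul_eq_mul, abs_mul] at huy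
  exact le_of_mul_le_mul_left huy (abs_pos.2 (left_ne_zero_of_smul hu))

/-- A compact polyhedron with nonempty interior, with facets parallel to members of `𝒱` and with
`ε`-separated vertices, contains a ball whose radius is a multiple of `ε`. -/
theorem exists_pos_forall_closedBall_subset_polyhedron (𝒱 : Finset (Submodule ℝ E))
    (h𝒱 : ∀ V ∈ 𝒱, V ≠ ⊤) :
    ∃ C > 0, ∀ ε > 0, ∀ S : Finset ((E →ₗ[ℝ] ℝ) × ℝ),
      IsCompact (polyhedronFace S ∅) → (interior (polyhedronFace S ∅)).Nonempty →
      (∀ p ∈ S, LinearMap.ker p.1 ∈ 𝒱) →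
      (∀ v ∈ (polyhedronFace S ∅).extremePoints ℝ, ∀ w ∈ (polyhedronFace S ∅).extremePoints ℝ,
        v ≠ w → ε ≤ dist v w) →
      ∃ x, Metric.closedBall x (C * ε) ⊆ polyhedronFace S ∅ := by
  choose! δ hδ hwidth using fun V (hV : V ∈ 𝒱) =>
    exists_pos_forall_polyhedron_width 𝒱 (h𝒱 V hV)
  set m : ℝ := 2 * (𝒱.card : ℝ) with hm
  obtain ⟨C, hCδ, hC⟩ : ∃ C : ℝ, (∀ V ∈ 𝒱, m * C ≤ δ V) ∧ 0 < C := by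
    have hev : ∀ᶠ C : ℝ in nhds 0, ∀ V ∈ 𝒱, m * C ≤ δ V := by
      refine (Filter.eventually_all_finset 𝒱).2 fun V hV => ?_
      have ht : Filter.Tendsto (fun C : ℝ => m * C) (nhds 0) (nhds 0) :=
        Continuous.tendsto' (by fun_prop) _ _ (by simp)
      exact ht.eventually_le_const (hδ V hV)
    exact ((hev.filter_mono nhdsWithin_le_nhds).and
      (self_mem_nhdsWithin : Set.Ioi (0 : ℝ) ∈ nhdsWithin 0 (Set.Ioi 0))).exists
  refine ⟨C, hC, fun ε hε S hP hint hS hsep => ?_⟩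
  choose! v hv w hw hvw using fun V hV => hwidth V hV ε hε S hP hint hS hsep
  refine ⟨m⁻¹ • ∑ V ∈ 𝒱, (v V + w V), fun z hz => ⟨fun p hp => ?_, by simp⟩⟩
  set x := m⁻¹ • ∑ V ∈ 𝒱, (v V + w V) with hx
  have hpV := hS p hp
  have hm0 : 0 < m := by
    have : 0 < 𝒱.card := Finset.card_pos.2 ⟨_, hpV⟩
    positivity
  have hball : |p.1 (m • (z - x))| ≤ |p.1 (v (LinearMap.ker p.1) - w (LinearMap.ker p.1))| := by
    refine hvw _ hpV p.1 rfl _ ?_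
    rw [Metric.mem_closedBall, dist_eq_norm] at hz
    rw [norm_smul, Real.norm_of_nonneg hm0.le]
    calc m * ‖z - x‖ ≤ m * (C * ε) := by gcongr
      _ = m * C * ε := by ring
      _ ≤ δ _ * ε := by gcongr; exact hCδ _ hpV
  have hle : ∀ V ∈ 𝒱, p.1 (v V) ≤ p.2 ∧ p.1 (w V) ≤ p.2 := fun V hV =>
    ⟨(hv V hV).1 p hp, (hw V hV).1 p hp⟩
  have hsum := Finset.single_le_sum (f := fun V => (p.2 - p.1 (v V)) + (p.2 - p.1 (w V)))
    (fun V hV => add_nonneg (sub_nonneg.2 (hle V hV).1) (sub_nonneg.2 (hle V hV).2)) hpV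
  have habs : |p.1 (v (LinearMap.ker p.1) - w (LinearMap.ker p.1))| ≤
      (p.2 - p.1 (v (LinearMap.ker p.1))) + (p.2 - p.1 (w (LinearMap.ker p.1))) := by
    obtain ⟨h1, h2⟩ := hle _ hpV
    rw [map_sub, abs_le]
    constructor <;> linarith
  have htotal : ∑ V ∈ 𝒱, ((p.2 - p.1 (v V)) + (p.2 - p.1 (w V))) = m * p.2 - m * p.1 x := by
    rw [hx, map_smul, smul_eq_mul, mul_inv_cancel_left₀ hm0.ne', map_sum]
    simp only [map_add, Finset.sum_add_distrib, Finset.sum_sub_distrib, Finset.sum_const,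
      nsmul_eq_mul, hm]
    ring
  have hz' : p.1 (m • (z - x)) = m * p.1 z - m * p.1 x := by
    rw [map_smul, map_sub, smul_eq_mul, mul_sub]
  refine le_of_mul_le_mul_left ?_ hm0
  have := le_abs_self (p.1 (m • (z - x)))
  linarith

end NormedSpace


/-- Geometric lemma. For a finite set `𝒱` of linear hyperplanes of `ℝ^n`
there is `C > 0` (depending only on `𝒱`) such that every compact polytope `P` with
nonempty interior, cut out by closed half-spaces whose boundary hyperplanes are translates
of members of `𝒱`, and whose vertices (extreme points) are pairwise at distance at least
`ε`, contains a closed ball of radius `C·ε`. -/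
theorem stmt_17 (n : ℕ) (hn : 1 ≤ n)
    (𝒱 : Finset (Submodule ℝ (EuclideanSpace ℝ (Fin n))))
    (h𝒱 : ∀ V ∈ 𝒱, Module.finrank ℝ ↥V = n - 1) :
    ∃ C > 0, ∀ ε > 0, ∀ P : Set (EuclideanSpace ℝ (Fin n)),
      IsCompact P → (interior P).Nonempty →
      (∃ S : Finset ((EuclideanSpace ℝ (Fin n) →ₗ[ℝ] ℝ) × ℝ),
        P = ⋂ p ∈ S, {x | p.1 x ≤ p.2} ∧ ∀ p ∈ S, LinearMap.ker p.1 ∈ 𝒱) →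
      (∀ v₁ ∈ Set.extremePoints ℝ P, ∀ v₂ ∈ Set.extremePoints ℝ P,
        v₁ ≠ v₂ → ε ≤ dist v₁ v₂) →
      ∃ x, Metric.closedBall x (C * ε) ⊆ P := by
  have hproper : ∀ V ∈ 𝒱, V ≠ ⊤ := by
    rintro V hV rfl
    have := h𝒱 ⊤ hV
    rw [finrank_top, finrank_euclideanSpace_fin] at this
    omega
  obtain ⟨C, hC, hball⟩ := exists_pos_forall_closedBall_subset_polyhedron 𝒱 hproper
  refine ⟨C, hC, fun ε hε P hP hint ⟨S, hPS, hS⟩ hsep => ?_⟩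
  obtain rfl : P = polyhedronFace S ∅ := by
    rw [hPS]
    ext x
    simp [polyhedronFace]
  exact hball ε hε S hP hint hS hsep
end

section
/- Let G ≤ ℝ^n be a subgroup which is free abelian of rank k, and let f = {V₁,…,V_n} be a flag of linear hyperplanes of ℝ^n (so ⋂_{i=1}^n V_i = {0}). Then 𝒱(G, f) := ⋂_{i=1}^n (V_i + G) is a subgroup of ℝ^n containing G, it is isomorphic as an abelian group to the direct sum ⨁_{i=1}^n G/(G ∩ V_i), and rk(𝒱(G, f)) = Σ_{i=1}^n (k − rk(G ∩ V_i)). (These are the vertex sets of translated hyperplane arrangements for a homogeneous polytopal cut and project scheme, with the supporting hyperplanes translated over the origin.) -/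
open scoped Pointwise

/-- The homomorphism `G → E ⧸ W` whose range is the image of `G` and whose kernel is `G ∩ W`. -/
def AddSubgroup.toQuotient {E : Type*} [AddCommGroup E] [Module ℝ E] (G : AddSubgroup E)
    (W : Submodule ℝ E) : G →+ E ⧸ W :=
  W.mkQ.toAddMonoidHom.comp G.subtype

section toQuotient

variable {E : Type*} [AddCommGroup E] [Module ℝ E] (G : AddSubgroup E) (W : Submodule ℝ E)

theorem AddSubgroup.toQuotient_apply (g : G) : G.toQuotient W g = W.mkQ (g : E) := rfl

theorem AddSubgroup.ker_toQuotient :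
    (G.toQuotient W).ker = W.toAddSubgroup.addSubgroupOf G := by
  ext g
  simp [AddMonoidHom.mem_ker, AddSubgroup.toQuotient_apply, AddSubgroup.mem_addSubgroupOf]

theorem AddSubgroup.mem_sup_iff_mkQ_mem_range {x : E} :
    x ∈ W.toAddSubgroup ⊔ G ↔ W.mkQ x ∈ (G.toQuotient W).range := by
  rw [AddSubgroup.mem_sup, AddMonoidHom.mem_range]
  constructor
  · rintro ⟨w, hw, g, hg, rfl⟩
    refine ⟨⟨g, hg⟩, ?_⟩
    have hw' : w ∈ W := hw
    simp [AddSubgroup.toQuotient_apply, hw']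
  · rintro ⟨g, hg⟩
    refine ⟨x - g, ?_, g, g.2, sub_add_cancel _ _⟩
    exact (Submodule.Quotient.eq W).1 hg.symm

/-- Rank-nullity for `G → E ⧸ W`. -/
theorem AddSubgroup.finrank_range_toQuotient [Module.Finite ℤ G] :
    Module.finrank ℤ (G.toQuotient W).range =
      Module.finrank ℤ G - Module.finrank ℤ ↥(G ⊓ W.toAddSubgroup) := by
  have h := (G.toQuotient W).toIntLinearMap.ker.finrank_quotient_add_finrank
  have hr : Module.finrank ℤ (G ⧸ (G.toQuotient W).toIntLinearMap.ker) =
      Module.finrank ℤ (G.toQuotient W).range :=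
    (G.toQuotient W).toIntLinearMap.quotKerEquivRange.finrank_eq
  let e : (G.toQuotient W).toIntLinearMap.ker ≃+ ↥(G ⊓ W.toAddSubgroup) :=
    { toFun := fun x => ⟨(x : G), (x : G).2,
        (Submodule.Quotient.mk_eq_zero W).1 (LinearMap.mem_ker.1 x.2)⟩
      invFun := fun x => ⟨⟨x, x.2.1⟩,
        LinearMap.mem_ker.2 ((Submodule.Quotient.mk_eq_zero W).2 x.2.2)⟩
      left_inv := fun _ => rfl
      right_inv := fun _ => rfl
      map_add' := fun _ _ => rfl }
  have hk := e.toIntLinearEquiv.finrank_eq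
  rw [hr, hk] at h
  omega

theorem AddSubgroup.finite_and_free_range_toQuotient [Module.Finite ℤ G] :
    Module.Finite ℤ (G.toQuotient W).range ∧ Module.Free ℤ (G.toQuotient W).range := by
  have : Module.Finite ℤ (G.toQuotient W).range :=
    Module.Finite.of_surjective (G.toQuotient W).rangeRestrict.toIntLinearMap
      (G.toQuotient W).rangeRestrict_surjective
  have : IsAddTorsionFree (E ⧸ W) := IsAddTorsionFree.of_isTorsionFree ℝ _
  exact ⟨inferInstance, inferInstance⟩

/-- If `E` is the product of its quotients `E ⧸ V i`, then `⋂ i, (V i + G)` is the product of the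
images of `G` in these quotients. -/
theorem AddSubgroup.nonempty_iInf_sup_equiv_pi {ι : Type*}
    (V : ι → Submodule ℝ E)
    (hbij : Function.Bijective (LinearMap.pi fun i => (V i).mkQ)) :
    Nonempty (↥(⨅ i, ((V i).toAddSubgroup ⊔ G)) ≃+ ∀ i, (G.toQuotient (V i)).range) := by
  let φ : ↥(⨅ i, ((V i).toAddSubgroup ⊔ G)) →+ ∀ i, (G.toQuotient (V i)).range :=
    { toFun := fun x i => ⟨(V i).mkQ x,
        (G.mem_sup_iff_mkQ_mem_range (V i)).1 (AddSubgroup.mem_iInf.1 x.2 i)⟩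
      map_zero' := by ext i; simp
      map_add' := fun x y => by ext i; simp }
  refine ⟨AddEquiv.ofBijective φ ⟨fun x y hxy => ?_, fun y => ?_⟩⟩
  · exact Subtype.ext (hbij.1 (funext fun i => congrArg Subtype.val (congrFun hxy i)))
  · obtain ⟨x, hx⟩ := hbij.2 fun i => (y i : E ⧸ V i)
    have hx' : ∀ i, (V i).mkQ x = y i := congrFun hx
    refine ⟨⟨x, AddSubgroup.mem_iInf.2 fun i => (G.mem_sup_iff_mkQ_mem_range (V i)).2 ?_⟩,
      funext fun i => Subtype.ext (hx' i)⟩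
    rw [hx' i]
    exact (y i).2

end toQuotient

theorem bijective_pi_mkQ_of_iInf_eq_bot {n : ℕ} (hn : 1 ≤ n)
    (V : Fin n → Submodule ℝ (Fin n → ℝ))
    (hhyp : ∀ i, Module.finrank ℝ ↥(V i) = n - 1) (hflag : ⨅ i, V i = ⊥) :
    Function.Bijective (LinearMap.pi fun i => (V i).mkQ) := by
  have hinj : Function.Injective (LinearMap.pi fun i => (V i).mkQ) := by
    rw [← LinearMap.ker_eq_bot, LinearMap.ker_pi]
    simpa using hflag
  have hq : ∀ i, Module.finrank ℝ ((Fin n → ℝ) ⧸ V i) = 1 := fun i => by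
    have h := (V i).finrank_quotient_add_finrank
    rw [hhyp i, Module.finrank_fin_fun] at h
    omega
  refine ⟨hinj, (LinearMap.injective_iff_surjective_of_finrank_eq_finrank ?_).1 hinj⟩
  simp [Module.finrank_pi_fintype, hq]

/-- For a free abelian subgroup `G ≤ ℝ^n` of rank `k` and a flag
`f = {V₁,…,V_n}` of linear hyperplanes, the vertex set `𝒱(G,f) = ⋂ᵢ (Vᵢ + G)` is a
subgroup of `ℝ^n` containing `G` (it equals the subgroup `⨅ᵢ (Vᵢ ⊔ G)`), it is
isomorphic to `⨁ᵢ G/(G ∩ Vᵢ)`, and its rank is `Σᵢ (k − rk(G ∩ Vᵢ))`. -/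
theorem stmt_18 (n k : ℕ) (hn : 1 ≤ n)
    (G : AddSubgroup (Fin n → ℝ)) [Module.Free ℤ ↥G] [Module.Finite ℤ ↥G]
    (hG : Module.finrank ℤ ↥G = k)
    (V : Fin n → Submodule ℝ (Fin n → ℝ)) (hVinj : Function.Injective V)
    (hhyp : ∀ i, Module.finrank ℝ ↥(V i) = n - 1)
    (hflag : ⨅ i, V i = ⊥) :
    (((⨅ i, ((V i).toAddSubgroup ⊔ G)) : AddSubgroup (Fin n → ℝ)) : Set (Fin n → ℝ))
        = ⋂ i, ((V i : Set (Fin n → ℝ)) + (G : Set (Fin n → ℝ))) ∧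
    G ≤ ⨅ i, ((V i).toAddSubgroup ⊔ G) ∧
    Nonempty ((↥(⨅ i, ((V i).toAddSubgroup ⊔ G))) ≃+
      (DirectSum (Fin n) fun i => ↥G ⧸ ((V i).toAddSubgroup.addSubgroupOf G))) ∧
    Module.finrank ℤ ↥(⨅ i, ((V i).toAddSubgroup ⊔ G)) =
      ∑ i, (k - Module.finrank ℤ ↥(G ⊓ (V i).toAddSubgroup)) := by
  obtain ⟨e⟩ := G.nonempty_iInf_sup_equiv_pi V (bijective_pi_mkQ_of_iInf_eq_bot hn V hhyp hflag)
  refine ⟨?_, le_iInf fun i => le_sup_right, ⟨?_⟩, ?_⟩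
  · rw [AddSubgroup.coe_iInf]
    exact Set.iInter_congr fun i => AddSubgroup.add_normal _ _
  · refine e.trans ((AddEquiv.piCongrRight fun i => ?_).trans (DirectSum.addEquivProd _).symm)
    exact (QuotientAddGroup.quotientKerEquivRange _).symm.trans
      (QuotientAddGroup.quotientAddEquivOfEq (G.ker_toQuotient (V i)))
  · have := fun i => (G.finite_and_free_range_toQuotient (V i)).1
    have := fun i => (G.finite_and_free_range_toQuotient (V i)).2
    rw [e.toIntLinearEquiv.finrank_eq, Module.finrank_pi_fintype]
    simp only [AddSubgroup.finrank_range_toQuotient, hG]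
end

section
/- Let n ≥ 1, k ≥ n + 1, and let u₁,…,u_k ∈ ℝ^n be vectors such that every n-element subset of {u₁,…,u_k} is linearly independent (the non-degeneracy condition). Let ℋ₀ be the set of linear subspaces of ℝ^n spanned by the (n−1)-element subsets of {u₁,…,u_k}; each such subspace is a linear hyperplane and ⋂ℋ₀ = {0}. Then ℋ₀ is indecomposable: there is no partition ℋ₀ = A ⊔ B into nonempty subsets with ⋂_{V∈A} V + ⋂_{V∈B} V = ℝ^n. (This is the statement that a non-degenerate canonical cut and project window, whose supporting subspaces are spanned by (n−1)-subsets of the projected standard basis vectors, is indecomposable.) -/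
/-- The supporting subspaces of a non-degenerate canonical window: the spans of the
`(n−1)`-element subsets of the projected standard basis vectors `u₁,…,u_k`. -/
def canonicalH0 (n k : ℕ) (u : Fin k → (Fin n → ℝ)) : Set (Submodule ℝ (Fin n → ℝ)) :=
  {V | ∃ s : Finset (Fin k), s.card = n - 1 ∧ V = Submodule.span ℝ (u '' ↑s)}

section GeneralPosition

variable {n k : ℕ} {u : Fin k → (Fin n → ℝ)}

theorem linearIndepOn_of_card_le (hk : n ≤ k)
    (hnd : ∀ s : Finset (Fin k), s.card = n → LinearIndependent ℝ (fun i : ↥s => u i))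
    {s : Finset (Fin k)} (hs : s.card ≤ n) : LinearIndepOn ℝ u (s : Set (Fin k)) := by
  obtain ⟨t, hst, -, ht⟩ := Finset.exists_subsuperset_card_eq (Finset.subset_univ s) hs (by simpa)
  have h : LinearIndepOn ℝ u (t : Set (Fin k)) := hnd t ht
  exact h.mono (Finset.coe_subset.2 hst)

theorem finrank_span_image_of_card_le (hk : n ≤ k)
    (hnd : ∀ s : Finset (Fin k), s.card = n → LinearIndependent ℝ (fun i : ↥s => u i))
    {s : Finset (Fin k)} (hs : s.card ≤ n) :
    Module.finrank ℝ (Submodule.span ℝ (u '' ↑s)) = s.card := by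
  have h : LinearIndependent ℝ (fun i : ↥s => u i) := linearIndepOn_of_card_le hk hnd hs
  have h' := finrank_span_eq_card h
  rw [Fintype.card_coe] at h'
  rwa [Set.image_eq_range]

theorem card_le_finrank_of_forall_mem (hk : n ≤ k)
    (hnd : ∀ s : Finset (Fin k), s.card = n → LinearIndependent ℝ (fun i : ↥s => u i))
    {S : Submodule ℝ (Fin n → ℝ)} (hS : Module.finrank ℝ S < n) {P : Finset (Fin k)}
    (hP : ∀ j ∈ P, u j ∈ S) : P.card ≤ Module.finrank ℝ S := by
  by_contra! h
  obtain ⟨Q, hQP, hQ⟩ := Finset.exists_subset_card_eq (Nat.succ_le_of_lt h)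
  have hle : Submodule.span ℝ (u '' ↑Q) ≤ S := by
    rw [Submodule.span_le]
    rintro _ ⟨j, hj, rfl⟩
    exact hP j (hQP hj)
  have := Submodule.finrank_mono hle
  rw [finrank_span_image_of_card_le hk hnd (by omega)] at this
  omega

theorem eq_zero_of_forall_mem_span_erase {I : Finset (Fin k)} (hI : I.card = n)
    (hli : LinearIndependent ℝ (fun i : ↥I => u i)) {x : Fin n → ℝ}
    (hx : ∀ i ∈ I, x ∈ Submodule.span ℝ (u '' ↑(I.erase i))) : x = 0 := by
  rcases I.eq_empty_or_nonempty with rfl | hne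
  · obtain rfl : n = 0 := by simpa using hI.symm
    exact Subsingleton.elim _ _
  have : Nonempty ↥I := hne.to_subtype
  let b := basisOfLinearIndependentOfCardEqFinrank hli (by simpa using hI)
  apply b.ext_elem
  intro i
  have himg : u '' ↑(I.erase i) = b '' {j | j ≠ i} := by
    ext y
    simp only [b, Set.mem_image, Finset.mem_coe, Finset.mem_erase,
      coe_basisOfLinearIndependentOfCardEqFinrank, Set.mem_ofPred_eq, Subtype.exists, ne_eq,
      Subtype.ext_iff]
    grind
  have hxi := hx i i.2
  rw [himg, b.mem_span_image] at hxi
  by_contra hne'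
  have : i ∈ (b.repr x).support := by simpa using hne'
  exact hxi this rfl

theorem sInf_canonicalH0 (hk : n ≤ k)
    (hnd : ∀ s : Finset (Fin k), s.card = n → LinearIndependent ℝ (fun i : ↥s => u i)) :
    sInf (canonicalH0 n k u) = ⊥ := by
  rw [eq_bot_iff]
  intro x hx
  obtain ⟨I, hI⟩ : ∃ I : Finset (Fin k), I.card = n := by
    obtain ⟨I, -, hI⟩ := Finset.exists_subset_card_eq (s := (Finset.univ : Finset (Fin k))) (n := n)
      (by simpa)
    exact ⟨I, hI⟩
  rw [Submodule.mem_sInf] at hx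
  exact eq_zero_of_forall_mem_span_erase hI (hnd I hI) fun i hi =>
    hx _ ⟨I.erase i, by rw [Finset.card_erase_of_mem hi, hI], rfl⟩

/-- If `S + T` is the whole space and every subspace in `ℋ₀` contains `S` or `T`, then
every `u j` lies in `S` or in `T`. -/
theorem mem_or_mem_of_sup_eq_top (hn : 1 ≤ n) (hk : n ≤ k)
    (hnd : ∀ s : Finset (Fin k), s.card = n → LinearIndependent ℝ (fun i : ↥s => u i))
    {S T : Submodule ℝ (Fin n → ℝ)} (hST : S ⊔ T = ⊤)
    (h : ∀ V ∈ canonicalH0 n k u, S ≤ V ∨ T ≤ V) (j : Fin k) : u j ∈ S ∨ u j ∈ T := by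
  obtain ⟨I, hjI, -, hI⟩ := Finset.exists_subsuperset_card_eq
    (Finset.subset_univ ({j} : Finset (Fin k))) (n := n) (by simpa) (by simpa)
  rw [Finset.singleton_subset_iff] at hjI
  obtain ⟨s, hs, t, ht, hst⟩ := Submodule.mem_sup.1 (hST ▸ Submodule.mem_top : u j ∈ S ⊔ T)
  have hH : ∀ i ∈ I, S ≤ Submodule.span ℝ (u '' ↑(I.erase i)) ∨
      T ≤ Submodule.span ℝ (u '' ↑(I.erase i)) := fun i hi =>
    h _ ⟨I.erase i, by rw [Finset.card_erase_of_mem hi, hI], rfl⟩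
  have huj : ∀ i ∈ I, i ≠ j → s + t ∈ Submodule.span ℝ (u '' ↑(I.erase i)) := fun i _ hij =>
    hst ▸ Submodule.subset_span ⟨j, by simp [hjI, hij.symm], rfl⟩
  rcases hH j hjI with hj | hj
  · have hs0 : s = 0 := eq_zero_of_forall_mem_span_erase hI (hnd I hI) fun i hi => by
      by_cases hij : i = j
      · exact hij ▸ hj hs
      · rcases hH i hi with h' | h'
        · exact h' hs
        · exact (Submodule.add_mem_iff_left _ (h' ht)).1 (huj i hi hij)
    right
    rwa [← hst, hs0, zero_add]
  · have ht0 : t = 0 := eq_zero_of_forall_mem_span_erase hI (hnd I hI) fun i hi => by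
      by_cases hij : i = j
      · exact hij ▸ hj ht
      · rcases hH i hi with h' | h'
        · exact (Submodule.add_mem_iff_right _ (h' hs)).1 (huj i hi hij)
        · exact h' ht
    left
    rwa [← hst, ht0, add_zero]

end GeneralPosition


/-- If every `n`-element subset of `u₁,…,u_k ∈ ℝ^n` (with `k ≥ n+1`) is
linearly independent, then each member of `ℋ₀` is a linear hyperplane, `⋂ℋ₀ = {0}`, and
`ℋ₀` is indecomposable: there is no partition `ℋ₀ = A ⊔ B` into nonempty parts with
`(⋂_{V∈A} V) + (⋂_{V∈B} V) = ℝ^n`. -/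
theorem stmt_19 (n k : ℕ) (hn : 1 ≤ n) (hk : n + 1 ≤ k)
    (u : Fin k → (Fin n → ℝ))
    (hnd : ∀ s : Finset (Fin k), s.card = n →
      LinearIndependent ℝ (fun i : ↥s => u i)) :
    (∀ V ∈ canonicalH0 n k u, Module.finrank ℝ ↥V = n - 1) ∧
    sInf (canonicalH0 n k u) = ⊥ ∧
    ¬ ∃ A B : Set (Submodule ℝ (Fin n → ℝ)), A ∪ B = canonicalH0 n k u ∧
        Disjoint A B ∧ A.Nonempty ∧ B.Nonempty ∧ sInf A ⊔ sInf B = ⊤ := by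
  have hk' : n ≤ k := by omega
  have hfin : ∀ V ∈ canonicalH0 n k u, Module.finrank ℝ ↥V = n - 1 := by
    rintro _ ⟨s, hs, rfl⟩
    rw [finrank_span_image_of_card_le hk' hnd (by omega), hs]
  refine ⟨hfin, sInf_canonicalH0 hk' hnd, ?_⟩
  rintro ⟨A, B, hAB, -, ⟨V, hV⟩, ⟨W, hW⟩, htop⟩
  have hinf : sInf A ⊓ sInf B = ⊥ := by rw [← sInf_union, hAB, sInf_canonicalH0 hk' hnd]
  have hmem := mem_or_mem_of_sup_eq_top hn hk' hnd htop fun X hX =>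
    (hAB ▸ hX : X ∈ A ∪ B).imp (fun h => sInf_le h) (fun h => sInf_le h)
  have hA : Module.finrank ℝ ↥(sInf A) < n := by
    have := Submodule.finrank_mono (sInf_le hV)
    have := hfin V (hAB ▸ Or.inl hV)
    omega
  have hB : Module.finrank ℝ ↥(sInf B) < n := by
    have := Submodule.finrank_mono (sInf_le hW)
    have := hfin W (hAB ▸ Or.inr hW)
    omega
  have hdim := Submodule.finrank_sup_add_finrank_inf_eq (sInf A) (sInf B)
  rw [htop, hinf, finrank_top, finrank_bot, Module.finrank_fin_fun] at hdim
  classical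
  have hPA := card_le_finrank_of_forall_mem hk' hnd hA
    (P := Finset.univ.filter fun j => u j ∈ sInf A) fun j hj => (Finset.mem_filter.1 hj).2
  have hPB := card_le_finrank_of_forall_mem hk' hnd hB
    (P := Finset.univ.filter fun j => ¬ u j ∈ sInf A) fun j hj =>
      (hmem j).resolve_left (Finset.mem_filter.1 hj).2
  have hcard := Finset.card_filter_add_card_filter_not (s := (Finset.univ : Finset (Fin k)))
    (fun j => u j ∈ sInf A)
  rw [Finset.card_univ, Fintype.card_fin] at hcard
  omega
end
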